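/- arXiv:1308.3469 — 6 statements merged into one kernel-verified Lean document; each statement's English description precedes it below -/
import Mathlib

section
/- For all nonnegative integers n, k, P, p with 2p ≤ P ≤ n, the sum over all sextuples (R, S, T, U, V, C) of nonnegative integers satisfying R + S + T + U + V + C = n, 2T + S + V = k, R + S + U = P, and S + U = 2p, of the quantity [(n − P)! / (T! · V! · C!)] · (binomial coefficient (2p choose S)) · 2^V, equals the binomial coefficient (2(n − P + p) choose k). (This is Lemma 6.3 of the paper: the coefficient ρ(σ, k) arising in the Wick-product expansion equals (2(n − |σ|) choose k), where P = |σ|₊ is the weighted size of the chain/cycle pattern σ, p is its number of chains, and |σ| = P − p.) -/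
open Finset

open Polynomial in
theorem aux_binom (a N : ℕ) (h : a ≤ N) (x : ℚ[X]) (y : ℚ[X]) :
    (x + y) ^ a = ∑ i ∈ range (N + 1), x ^ i * y ^ (a - i) * ((a.choose i : ℕ) : ℚ[X]) := by
  rw [add_pow]
  apply Finset.sum_subset
  · intro i hi
    simp only [mem_range] at *
    omega
  · intro i _ hi
    simp only [mem_range] at hi
    rw [Nat.choose_eq_zero_of_lt (by omega)]
    simp

open Polynomial in
theorem aux_coeff (N m q k : ℕ) (hm : m ≤ N) (hq : q ≤ N) :
    ∑ S ∈ range (N + 1), ∑ T ∈ range (N + 1), ∑ V ∈ range (N + 1),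
      (if k = 2 * T + S + V then
        ((q.choose S : ℕ) : ℚ) * ((m.choose T : ℕ) : ℚ) * (((m - T).choose V : ℕ) : ℚ) * 2 ^ V
        else 0) = (((2 * m + q).choose k : ℕ) : ℚ) := by
  have key : ((X : ℚ[X]) + 1) ^ (2 * m + q) =
      ∑ S ∈ range (N + 1), ∑ T ∈ range (N + 1), ∑ V ∈ range (N + 1),
        C (((q.choose S : ℕ) : ℚ) * ((m.choose T : ℕ) : ℚ) * (((m - T).choose V : ℕ) : ℚ) * 2 ^ V)
          * X ^ (2 * T + S + V) := by
    have e : ((X : ℚ[X]) + 1) ^ (2 * m + q) = (X + 1) ^ q * (X ^ 2 + (2 * X + 1)) ^ m := by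
      rw [pow_add, pow_mul, mul_comm]
      congr 2
      ring
    rw [e, aux_binom q N hq, aux_binom m N hm, Finset.sum_mul_sum]
    refine Finset.sum_congr rfl fun S _ => Finset.sum_congr rfl fun T _ => ?_
    rw [aux_binom (m - T) N (by omega), Finset.mul_sum, Finset.sum_mul, Finset.mul_sum]
    refine Finset.sum_congr rfl fun V _ => ?_
    simp only [one_pow, mul_one, map_mul, map_natCast, map_pow, map_ofNat]
    ring
  have h := congrArg (fun f : ℚ[X] => f.coeff k) key
  simp only [coeff_X_add_one_pow, finset_sum_coeff, coeff_C_mul, coeff_X_pow, mul_ite, mul_one,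
    mul_zero] at h
  exact h.symm

/-- Lemma 6.3 of the paper: the coefficient ρ(σ,k) from the Wick-product expansion
equals `(2(n − |σ|)).choose k`, where `P = |σ|₊` and `p` is the number of chains,
so `n − |σ| = n − P + p`. -/
theorem rho_eq_choose (n k P p : ℕ) (h1 : 2 * p ≤ P) (h2 : P ≤ n) :
    ∑ R ∈ range (n + 1), ∑ S ∈ range (n + 1), ∑ T ∈ range (n + 1),
      ∑ U ∈ range (n + 1), ∑ V ∈ range (n + 1), ∑ C ∈ range (n + 1),
        (if R + S + T + U + V + C = n ∧ 2 * T + S + V = k ∧ R + S + U = P ∧ S + U = 2 * p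
          then ((n - P).factorial : ℚ) /
              ((T.factorial : ℚ) * (V.factorial : ℚ) * (C.factorial : ℚ)) *
              (((2 * p).choose S : ℕ) : ℚ) * 2 ^ V
          else 0)
      = (((2 * (n - P + p)).choose k : ℕ) : ℚ) := by
  obtain ⟨m, rfl⟩ := Nat.exists_eq_add_of_le h2
  have e : 2 * (P + m - P + p) = 2 * m + 2 * p := by omega
  rw [e, ← aux_coeff (P + m) m (2 * p) k (by omega) (by omega)]
  rw [Finset.sum_eq_single (P - 2 * p)]
  rotate_left
  · intro R _ hR
    refine Finset.sum_eq_zero fun S _ => Finset.sum_eq_zero fun T _ => Finset.sum_eq_zero fun U _ =>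
      Finset.sum_eq_zero fun V _ => Finset.sum_eq_zero fun C _ => ?_
    rw [if_neg (by omega)]
  · intro h
    simp only [mem_range] at h
    omega
  refine Finset.sum_congr rfl fun S _ => Finset.sum_congr rfl fun T _ => ?_
  rw [Finset.sum_eq_single (2 * p - S)]
  rotate_left
  · intro U _ hU
    refine Finset.sum_eq_zero fun V _ => Finset.sum_eq_zero fun C _ => ?_
    rw [if_neg (by omega)]
  · intro h
    simp only [mem_range] at h
    omega
  refine Finset.sum_congr rfl fun V _ => ?_
  rw [Finset.sum_eq_single (m - T - V)]
  rotate_left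
  · intro C _ hC
    rw [if_neg (by omega)]
  · intro h
    simp only [mem_range] at h
    omega
  rw [Nat.add_sub_cancel_left]
  by_cases hS : S ≤ 2 * p
  · by_cases hT : T + V ≤ m
    · by_cases hk : k = 2 * T + S + V
      · rw [if_pos (by omega), if_pos hk, Nat.cast_choose ℚ (show T ≤ m by omega),
          Nat.cast_choose ℚ (show V ≤ m - T by omega)]
        have h1 := Nat.cast_ne_zero (R := ℚ).2 (Nat.factorial_ne_zero T)
        have h2 := Nat.cast_ne_zero (R := ℚ).2 (Nat.factorial_ne_zero V)
        have h3 := Nat.cast_ne_zero (R := ℚ).2 (Nat.factorial_ne_zero (m - T))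
        have h4 := Nat.cast_ne_zero (R := ℚ).2 (Nat.factorial_ne_zero (m - T - V))
        field_simp
      · rw [if_neg (by omega), if_neg hk]
    · rw [if_neg (by omega)]
      have : m.choose T = 0 ∨ (m - T).choose V = 0 := by
        by_cases h : m < T
        · exact Or.inl (Nat.choose_eq_zero_of_lt h)
        · exact Or.inr (Nat.choose_eq_zero_of_lt (by omega))
      rcases this with h | h <;> simp [h]
  · rw [if_neg (by omega), Nat.choose_eq_zero_of_lt (show 2 * p < S by omega)]
    simp
end

section
/- (Lemma 3.1, first identity.) For every real x, every real u ≥ 0, and every real s with |s|·u < 1, the series ∑_{n=0}^∞ (s^n / (2^n · n!)) · P_{2n}(x, u) converges and equals (1 + u·s)^{−1/2} · exp( s·x² / (2·(1 + u·s)) ). -/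
/-- The Wick polynomial `P_n(x,u) = :x^n:` for variance `u`. -/
noncomputable def wickP (n : ℕ) (x u : ℝ) : ℝ :=
  ∑ j ∈ Finset.range (n / 2 + 1),
    (-1) ^ j * ((n.choose (2 * j) : ℕ) : ℝ) *
      (((2 * j).factorial : ℝ) / ((j.factorial : ℝ) * 2 ^ j)) * u ^ j * x ^ (n - 2 * j)


lemma wick_c (k j : ℕ) : Ring.choose (((k:ℝ) + 1/2) + j - 1) j =
    ((2 * (j + k)).factorial * k.factorial : ℝ) /
      ((j + k).factorial * j.factorial * 4 ^ j * (2 * k).factorial) := by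
  have h1 : Ring.choose (((k:ℝ) + 1/2) + j - 1) j = Ring.multichoose ((k:ℝ) + 1/2) j := by
    rw [Ring.choose]; congr 1; ring
  have h2 := Ring.factorial_nsmul_multichoose_eq_ascPochhammer ((k:ℝ) + 1/2) j
  rw [Polynomial.ascPochhammer_smeval_eq_eval, nsmul_eq_mul] at h2
  have h3 : (ascPochhammer ℝ j).eval ((k:ℝ)+1/2) = ((2 * (j + k)).factorial * k.factorial : ℝ) /
      ((j + k).factorial * 4 ^ j * (2 * k).factorial) := by
    clear h1 h2
    induction j with
    | zero => simp; field_simp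
    | succ j ih =>
      rw [ascPochhammer_succ_eval, ih]
      have e1 : 2 * (j + 1 + k) = 2 * (j + k) + 1 + 1 := by ring
      have e2 : j + 1 + k = (j + k) + 1 := by ring
      rw [e1, e2, Nat.factorial_succ, Nat.factorial_succ, Nat.factorial_succ]
      push_cast
      have := Nat.factorial_ne_zero (j+k)
      have := Nat.factorial_ne_zero (2 * k)
      field_simp
      ring
  rw [h1]
  have := Nat.factorial_ne_zero (j+k)
  have := Nat.factorial_ne_zero (2 * k)
  have := Nat.factorial_ne_zero j
  rw [h3] at h2
  field_simp at h2 ⊢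
  linarith

lemma wick_inner (k : ℕ) (y : ℝ) (hy : |y| < 1) :
    HasSum (fun j : ℕ => Ring.choose (((k:ℝ) + 1/2) + j - 1) j * y ^ j)
      (1 / (1 - y) ^ ((k:ℝ) + 1/2)) := by
  have h := (Real.one_div_one_sub_rpow_hasFPowerSeriesOnBall_zero ((k:ℝ)+1/2)).hasSum (y := y)
    (by simpa [Metric.mem_eball, edist_dist, Real.dist_eq] using hy)
  simpa [FormalMultilinearSeries.ofScalars, mul_comm] using h

lemma wick_outer (z y : ℝ) (hy : |y| < 1) :
    HasSum (fun k : ℕ => z ^ k / k.factorial * (1 / (1 - y) ^ ((k:ℝ) + 1/2)))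
      ((1 - y) ^ (-(1 / 2) : ℝ) * Real.exp (z / (1 - y))) := by
  have hp : 0 < 1 - y := by linarith [(abs_lt.mp hy).2]
  have h := (NormedSpace.expSeries_div_hasSum_exp (𝔸 := ℝ) (z / (1 - y))).mul_left
    ((1 - y) ^ (-(1 / 2) : ℝ))
  rw [← Real.exp_eq_exp_ℝ] at h
  refine h.congr_fun ?_ 
  intro k
  rw [Real.rpow_add hp, Real.rpow_natCast, Real.rpow_neg hp.le, div_pow]
  field_simp

lemma wick_prod (z y : ℝ) (hy : |y| < 1) :
    HasSum (fun p : ℕ × ℕ => z ^ p.1 / p.1.factorial *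
      (Ring.choose (((p.1:ℝ) + 1/2) + p.2 - 1) p.2 * y ^ p.2))
      ((1 - y) ^ (-(1 / 2) : ℝ) * Real.exp (z / (1 - y))) := by
  have hc : ∀ k j : ℕ, 0 ≤ Ring.choose (((k:ℝ) + 1/2) + j - 1) j := by
    intro k j; rw [wick_c]; positivity
  have hs : Summable (fun p : ℕ × ℕ => z ^ p.1 / p.1.factorial *
      (Ring.choose (((p.1:ℝ) + 1/2) + p.2 - 1) p.2 * y ^ p.2)) := by
    rw [← summable_abs_iff, summable_prod_of_nonneg (fun _ => abs_nonneg _)]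
    have hi := fun k => (wick_inner k (|y|) (by simpa using hy)).mul_left (|z| ^ k / k.factorial)
    simp only [abs_mul, abs_div, abs_pow, Nat.abs_cast, abs_of_nonneg (hc _ _)]
    refine ⟨fun k => (hi k).summable, ?_⟩
    simp only [(hi _).tsum_eq]
    exact (wick_outer (|z|) (|y|) (by simpa using hy)).summable
  have h := hs.hasSum.prod_fiberwise (fun k => (wick_inner k y hy).mul_left (z ^ k / k.factorial))
  rw [← h.unique (wick_outer z y hy)]
  exact hs.hasSum

/-- Lemma 3.1, first identity (lag.1):
`∑_{n≥0} (s^n/(2^n n!)) P_{2n}(x,u) = (1+us)^{−1/2} exp(s x²/(2(1+us)))`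
for `u ≥ 0` and `|s| u < 1`. -/
theorem wickP_even_generating (x u s : ℝ) (hu : 0 ≤ u) (hs : |s| * u < 1) :
    HasSum (fun n : ℕ => s ^ n / (2 ^ n * (n.factorial : ℝ)) * wickP (2 * n) x u)
      ((1 + u * s) ^ (-(1 / 2) : ℝ) * Real.exp (s * x ^ 2 / (2 * (1 + u * s)))) := by
  have hy : |-(u * s)| < 1 := by
    rw [abs_neg, abs_mul, abs_of_nonneg hu, mul_comm]; exact hs
  have h := wick_prod (s * x ^ 2 / 2) (-(u * s)) hy
  rw [sub_neg_eq_add, div_div] at h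
  rw [← (Equiv.prodComm ℕ ℕ).hasSum_iff,
    ← Finset.HasAntidiagonal.sigmaAntidiagonalEquivProd.hasSum_iff] at h
  have h2 := h.sigma (fun n => hasSum_fintype _)
  refine h2.congr_fun ?_
  intro n
  rw [Finset.univ_eq_attach]
  simp only [Function.comp_def, Finset.HasAntidiagonal.sigmaAntidiagonalEquivProd_apply, Equiv.prodComm_apply, Prod.fst_swap, Prod.snd_swap]
  rw [Finset.sum_attach (Finset.HasAntidiagonal.antidiagonal n) (fun p : ℕ × ℕ => (s * x ^ 2 / 2) ^ p.2 / p.2.factorial *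
      (Ring.choose (((p.2:ℝ) + 1/2) + p.1 - 1) p.1 * (-(u * s)) ^ p.1)),
    Finset.Nat.sum_antidiagonal_eq_sum_range_succ_mk, wickP, Finset.mul_sum,
    Nat.mul_div_cancel_left _ two_pos]
  refine Finset.sum_congr rfl fun j hj => ?_
  obtain ⟨k, rfl⟩ := Nat.exists_eq_add_of_le (Nat.lt_succ_iff.mp (Finset.mem_range.mp hj))
  have e : 2 * (j + k) - 2 * j = 2 * k := by omega
  simp only [Nat.add_sub_cancel_left]
  rw [wick_c, e, Nat.cast_choose ℝ (by omega : 2 * j ≤ 2 * (j + k)), e, neg_pow (u * s), mul_pow, div_pow,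
    mul_pow, pow_add, pow_add, ← pow_mul, (by norm_num : (4:ℝ) = 2 * 2), mul_pow]
  have := Nat.factorial_ne_zero (j+k)
  have := Nat.factorial_ne_zero (2 * k)
  have := Nat.factorial_ne_zero (2 * j)
  have := Nat.factorial_ne_zero j
  have := Nat.factorial_ne_zero k
  field_simp
end

section
/- (Lemma 3.1, second identity.) For every real x, every real α, every real u ≥ 0, and every real s with |s|·u < 1, the series ∑_{n=0}^∞ (s^n / n!) · W_n(x, u, α) converges and equals (1 + u·s)^{−1/2} · exp( s·(x/√2 + α)² / (1 + u·s) ), where W_n(x, u, α) := ∑_{j=0}^{2n} (2n choose j) · α^{2n−j} · 2^{−j/2} · P_j(x, u). -/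
/-- The shifted Wick power `W_n(x,u,α) = :(x/√2 + α)^{2n}:`
`= ∑_{j=0}^{2n} (2n choose j) α^{2n−j} 2^{−j/2} P_j(x,u)`. -/
noncomputable def wickW (n : ℕ) (x u α : ℝ) : ℝ :=
  ∑ j ∈ Finset.range (2 * n + 1),
    (((2 * n).choose j : ℕ) : ℝ) * α ^ (2 * n - j) * (2 : ℝ) ^ (-(j : ℝ) / 2) * wickP j x u

/-- Extend the summation range in `wickP`. -/
lemma wickP_eq_range (n N : ℕ) (h : n / 2 + 1 ≤ N) (x u : ℝ) :
    wickP n x u = ∑ j ∈ Finset.range N,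
      (-1) ^ j * ((n.choose (2 * j) : ℕ) : ℝ) *
      (((2 * j).factorial : ℝ) / ((j.factorial : ℝ) * 2 ^ j)) * u ^ j * x ^ (n - 2 * j) := by
  unfold wickP
  apply Finset.sum_subset
  · intro a ha
    simp only [Finset.mem_range] at *
    omega
  · intro a _ ha
    simp only [Finset.mem_range] at ha
    rw [Nat.choose_eq_zero_of_lt (by omega)]
    simp

lemma wickP_scale (n : ℕ) (x u c : ℝ) :
    c ^ n * wickP n x u = wickP n (c * x) (c ^ 2 * u) := by
  unfold wickP
  rw [Finset.mul_sum]
  apply Finset.sum_congr rfl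
  intro j hj
  simp only [Finset.mem_range] at hj
  have : c ^ n = (c ^ 2) ^ j * c ^ (n - 2 * j) := by
    rw [← pow_mul, ← pow_add]
    congr 1
    omega
  rw [this, mul_pow, mul_pow]
  ring

lemma binom_shift (m i : ℕ) (x α : ℝ) :
    ∑ j ∈ Finset.range (m + 1),
      ((m.choose j : ℕ) : ℝ) * α ^ (m - j) * (((j.choose i : ℕ) : ℝ) * x ^ (j - i)) =
      ((m.choose i : ℕ) : ℝ) * (x + α) ^ (m - i) := by
  by_cases hi : i ≤ m
  · obtain ⟨d, rfl⟩ := Nat.exists_eq_add_of_le hi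
    rw [add_assoc, Finset.sum_range_add, Finset.sum_eq_zero, zero_add, add_pow, Finset.mul_sum]
    · rw [show i + d - i = d by omega]
      apply Finset.sum_congr rfl
      intro j hj
      simp only [Finset.mem_range] at hj
      have h := Nat.choose_mul (n := i + d) (k := i + j) (s := i) (by omega) 
      rw [show i + d - i = d by omega, show i + j - i = j by omega] at h
      have h' : (((i+d).choose (i+j) : ℕ) : ℝ) * ((i+j).choose i : ℕ)
        = ((i+d).choose i : ℕ) * (d.choose j : ℕ) := by exact_mod_cast h
      rw [show i + d - (i + j) = d - j by omega, show i + j - i = j by omega]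
      linear_combination α ^ (d - j) * x ^ j * h'
    · intro j hj
      simp only [Finset.mem_range] at hj
      simp [Nat.choose_eq_zero_of_lt hj]
  · rw [Nat.choose_eq_zero_of_lt (by omega : m < i), Finset.sum_eq_zero]
    · simp
    · intro j hj
      simp only [Finset.mem_range] at hj
      simp [Nat.choose_eq_zero_of_lt (by omega : j < i)]

lemma wickP_shift (m : ℕ) (x u α : ℝ) :
    ∑ j ∈ Finset.range (m + 1), ((m.choose j : ℕ) : ℝ) * α ^ (m - j) * wickP j x u
      = wickP m (x + α) u := by
  have h1 : ∀ j ∈ Finset.range (m + 1),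
      ((m.choose j : ℕ) : ℝ) * α ^ (m - j) * wickP j x u =
      ∑ i ∈ Finset.range (m / 2 + 1),
        ((-1) ^ i * (((2 * i).factorial : ℝ) / ((i.factorial : ℝ) * 2 ^ i)) * u ^ i) *
        (((m.choose j : ℕ) : ℝ) * α ^ (m - j) *
          (((j.choose (2 * i) : ℕ) : ℝ) * x ^ (j - 2 * i))) := by
    intro j hj
    simp only [Finset.mem_range] at hj
    rw [wickP_eq_range j (m / 2 + 1) (by omega), Finset.mul_sum]
    exact Finset.sum_congr rfl fun i _ => by ring
  rw [Finset.sum_congr rfl h1, Finset.sum_comm, wickP]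
  apply Finset.sum_congr rfl
  intro i _
  rw [← Finset.mul_sum, binom_shift]
  ring

lemma wickW_eq (n : ℕ) (x u α : ℝ) :
    wickW n x u α = wickP (2 * n) (x / Real.sqrt 2 + α) (u / 2) := by
  rw [← wickP_shift, wickW]
  apply Finset.sum_congr rfl
  intro j _
  have h2 : (2 : ℝ) ^ (-(j : ℝ) / 2) = ((Real.sqrt 2)⁻¹) ^ j := by
    rw [Real.sqrt_eq_rpow, ← Real.rpow_neg (by norm_num), ← Real.rpow_natCast,
      ← Real.rpow_mul (by norm_num)]
    congr 1
    ring
  have h3 := wickP_scale j x u (Real.sqrt 2)⁻¹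
  rw [h2, mul_assoc, h3, inv_pow, Real.sq_sqrt (by norm_num)]
  congr 2 <;> ring

/-- The coefficients of the double series. -/
noncomputable def wickC (k j : ℕ) : ℝ :=
  ((2 * (j + k)).factorial : ℝ) /
    (((j + k).factorial : ℝ) * j.factorial * (2 * k).factorial * 4 ^ j)

lemma wickC_nonneg (k j : ℕ) : 0 ≤ wickC k j := by
  unfold wickC
  positivity

lemma asc_eq (k j : ℕ) : (ascPochhammer ℝ j).eval ((k : ℝ) + 1 / 2) *
    ((2 * k).factorial * (j + k).factorial * 4 ^ j) =
      k.factorial * (2 * (j + k)).factorial := by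
  induction j with
  | zero => simp; ring
  | succ j ih =>
    rw [ascPochhammer_succ_eval, show 2 * (j + 1 + k) = 2 * (j + k) + 1 + 1 by ring,
      show j + 1 + k = (j + k) + 1 by ring]
    simp only [Nat.factorial_succ, pow_succ]
    push_cast
    linear_combination (2 * ((j : ℝ) + k) + 1) * (2 * (j + k) + 2) * ih

lemma ring_choose_eq (k j : ℕ) :
    Ring.choose (((k : ℝ) + 1 / 2) + j - 1) j = k.factorial * wickC k j := by
  rw [← Ring.multichoose_eq]
  have h := Ring.factorial_nsmul_multichoose_eq_ascPochhammer ((k : ℝ) + 1 / 2) j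
  rw [Polynomial.ascPochhammer_smeval_cast, Polynomial.ascPochhammer_smeval_eq_eval,
    nsmul_eq_mul] at h
  have h2 := asc_eq k j
  rw [← h] at h2
  unfold wickC
  have := Nat.factorial_ne_zero j
  clear h
  generalize Ring.multichoose ((k : ℝ) + 1 / 2) j = c at *
  field_simp
  linear_combination h2

lemma hasSum_inner (k : ℕ) (t : ℝ) (ht : |t| < 1) :
    HasSum (fun j => wickC k j * t ^ j)
      ((1 / (k.factorial : ℝ)) * (1 / (1 - t) ^ ((k : ℝ) + 1 / 2))) := by
  have h := (Real.one_div_one_sub_rpow_hasFPowerSeriesOnBall_zero ((k : ℝ) + 1 / 2)).hasSum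
    (y := t) (by simpa [enorm_eq_nnnorm, ← NNReal.coe_lt_coe] using ht)
  simp only [zero_add] at h
  have h' := h.mul_left (1 / (k.factorial : ℝ))
  refine h'.congr_fun ?_ 
  intro j
  have e : (FormalMultilinearSeries.ofScalars ℝ
      (fun n : ℕ => Ring.choose (((k : ℝ) + 1 / 2) + n - 1) n) j) (fun _ => t)
      = k.factorial * wickC k j * t ^ j := by
    rw [← ring_choose_eq]
    simp [FormalMultilinearSeries.ofScalars]
  have := Nat.factorial_ne_zero k
  rw [e]
  field_simp

lemma hasSum_outer (a t : ℝ) (ht : t < 1) :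
    HasSum (fun k : ℕ => a ^ k * ((1 / (k.factorial : ℝ)) * (1 / (1 - t) ^ ((k : ℝ) + 1 / 2))))
      ((1 - t) ^ (-(1 / 2) : ℝ) * Real.exp (a / (1 - t))) := by
  have h := (NormedSpace.expSeries_div_hasSum_exp (a / (1 - t))).mul_left
    ((1 - t) ^ (-(1 / 2) : ℝ))
  rw [← Real.exp_eq_exp_ℝ] at h
  refine h.congr_fun ?_
  intro k
  have hp : 0 < 1 - t := by linarith
  rw [Real.rpow_add hp, Real.rpow_natCast, Real.rpow_neg hp.le, div_pow]
  have : (1 - t) ^ (1 / 2 : ℝ) ≠ 0 := (Real.rpow_pos_of_pos hp _).ne'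
  field_simp

lemma hasSum_double (a t : ℝ) (ht : |t| < 1) :
    HasSum (fun p : ℕ × ℕ => a ^ p.1 * (wickC p.1 p.2 * t ^ p.2))
      ((1 - t) ^ (-(1 / 2) : ℝ) * Real.exp (a / (1 - t))) := by
  have hs : Summable (fun p : ℕ × ℕ => a ^ p.1 * (wickC p.1 p.2 * t ^ p.2)) := by
    apply Summable.of_norm
    have e : (fun p : ℕ × ℕ => ‖a ^ p.1 * (wickC p.1 p.2 * t ^ p.2)‖) =
        fun p : ℕ × ℕ => |a| ^ p.1 * (wickC p.1 p.2 * |t| ^ p.2) := by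
      funext p
      simp [abs_of_nonneg (wickC_nonneg _ _)]
    rw [e, summable_prod_of_nonneg]
    · have hi : ∀ k, HasSum (fun j => |a| ^ k * (wickC k j * |t| ^ j)) _ := fun k =>
        (hasSum_inner k |t| (by simpa using ht)).mul_left (|a| ^ k)
      refine ⟨fun k => (hi k).summable, ?_⟩
      simp only [(hi _).tsum_eq]
      exact (hasSum_outer |a| |t| ht).summable
    · intro p
      have := wickC_nonneg p.1 p.2
      simp only [Pi.zero_apply]
      positivity
  have h1 := hs.hasSum.prod_fiberwise fun k => (hasSum_inner k t ht).mul_left (a ^ k)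
  rw [← h1.unique (hasSum_outer a t (lt_of_abs_lt ht))]
  exact hs.hasSum

lemma term_eq (n : ℕ) (y u s : ℝ) :
    s ^ n / (n.factorial : ℝ) * wickP (2 * n) y (u / 2) =
      ∑ p ∈ Finset.HasAntidiagonal.antidiagonal n, (s * y ^ 2) ^ p.2 * (wickC p.2 p.1 * (-(u * s)) ^ p.1) := by
  rw [Finset.Nat.sum_antidiagonal_eq_sum_range_succ_mk, wickP,
    show 2 * n / 2 + 1 = n.succ by omega, Finset.mul_sum]
  apply Finset.sum_congr rfl
  intro j hj
  simp only [Finset.mem_range] at hj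
  obtain ⟨k, rfl⟩ := Nat.exists_eq_add_of_le (show j ≤ n by omega)
  rw [show j + k - j = k by omega, show 2 * (j + k) - 2 * j = 2 * k by omega]
  have hc : (((2 * (j + k)).choose (2 * j) : ℕ) : ℝ) =
      (2 * (j + k)).factorial / ((2 * j).factorial * (2 * k).factorial) := by
    rw [Nat.cast_choose ℝ (by omega), show 2 * (j + k) - 2 * j = 2 * k by omega]
  rw [hc, wickC]
  have h4 : (4 : ℝ) ^ j = 2 ^ j * 2 ^ j := by rw [← mul_pow]; norm_num
  have h5 : (-(u * s)) ^ j = (-1) ^ j * u ^ j * s ^ j := by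
    rw [← mul_pow, ← mul_pow]; ring
  rw [h4, h5, mul_pow, div_pow, pow_add, ← pow_mul]
  have := Nat.factorial_ne_zero j
  have := Nat.factorial_ne_zero k
  field_simp

/-- Lemma 3.1, second identity (lag.2):
`∑_{n≥0} (s^n/n!) W_n(x,u,α) = (1+us)^{−1/2} exp(s (x/√2 + α)²/(1+us))`
for `u ≥ 0` and `|s| u < 1`. -/
theorem wickW_generating (x α u s : ℝ) (hu : 0 ≤ u) (hs : |s| * u < 1) :
    HasSum (fun n : ℕ => s ^ n / (n.factorial : ℝ) * wickW n x u α)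
      ((1 + u * s) ^ (-(1 / 2) : ℝ) *
        Real.exp (s * (x / Real.sqrt 2 + α) ^ 2 / (1 + u * s))) := by
  have ht : |-(u * s)| < 1 := by
    rw [abs_neg, abs_mul, abs_of_nonneg hu, mul_comm]
    exact hs
  have h := hasSum_double (s * (x / Real.sqrt 2 + α) ^ 2) (-(u * s)) ht
  rw [sub_neg_eq_add, ← (Equiv.prodComm ℕ ℕ).hasSum_iff,
    ← Finset.HasAntidiagonal.sigmaAntidiagonalEquivProd.hasSum_iff] at h
  have h2 := h.sigma (fun n => hasSum_fintype _)
  refine h2.congr_fun ?_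
  intro n
  rw [wickW_eq, term_eq, ← Finset.sum_coe_sort]
  rfl
end

section
/- (Identity (rilt.20): inversion of the renormalization recursion by chains.) Let ℓ ∈ ℝ and let c : ℕ → ℝ be any sequence with c(0) = 1. Define L : ℕ → ℝ by the recursion L(0) = 1 and, for n ≥ 1, L(n) = ℓ^n − ∑_σ [ n! / ( (n − |σ|₊)! · ∏_{i≥1} σ(i)! ) ] · ( ∏_{i≥1} c(i)^{σ(i)} ) · L(n − |σ|), where the sum runs over all finitely supported functions σ : {1,2,3,...} → ℕ with 1 ≤ |σ| and |σ|₊ ≤ n. Then for every n ∈ ℕ: ℓ^n = ∑_{k=0}^{n} (n!/k!) · ∑_{(j₁,...,j_k)} ( ∏_{b=1}^{k} c(j_b) ) · L(k), where the inner sum runs over all k-tuples (j₁,...,j_k) of nonnegative integers with ∑_{b=1}^{k} (j_b + 1) = n. -/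
open Finset

/-- `|σ| = ∑_{i≥1} i·σ(i)` for a finitely supported `σ : ℕ →₀ ℕ`
(with `σ 0 = 0` imposed separately, the `i = 0` term contributes nothing here). -/
def wdeg (σ : ℕ →₀ ℕ) : ℕ := σ.sum fun i k => i * k

/-- `|σ|₊ = ∑_{i≥1} (i+1)·σ(i)` for a finitely supported `σ : ℕ →₀ ℕ`. -/
def wdegp (σ : ℕ →₀ ℕ) : ℕ := σ.sum fun i k => (i + 1) * k

lemma ci_sum_eq (n : ℕ) (σ : ℕ →₀ ℕ) (hs : ∀ i, n < i → σ i = 0) :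
    σ.support ⊆ range (n + 1) := by
  intro i hi
  rw [mem_range]
  by_contra h
  exact (Finsupp.mem_support_iff.1 hi) (hs i (by omega))

lemma ci_le (σ : ℕ →₀ ℕ) (i : ℕ) : (i + 1) * σ i ≤ wdegp σ := by
  by_cases h : i ∈ σ.support
  · exact Finset.single_le_sum (f := fun i => (i + 1) * σ i) (fun _ _ => Nat.zero_le _) h
  · simp [Finsupp.notMem_support_iff.1 h]

lemma ci_bd {σ : ℕ →₀ ℕ} {n : ℕ} (h0 : σ 0 = 0) (h : wdegp σ ≤ n) (i : ℕ) (hi : n < i) :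
    σ i = 0 := by
  have := ci_le σ i
  by_contra h'
  have : 1 ≤ σ i := Nat.one_le_iff_ne_zero.2 h'
  nlinarith

lemma ci_finite (n : ℕ) : {σ : ℕ →₀ ℕ | σ 0 = 0 ∧ wdegp σ ≤ n}.Finite := by
  refine (Set.finite_Iic (Finsupp.onFinset (range (n + 1))
    (fun i => if i < n + 1 then n else 0) (by intro a; simp; omega))).subset ?_
  rintro σ ⟨h0, h⟩
  rw [Set.mem_Iic, Finsupp.le_def]
  intro i
  simp only [Finsupp.onFinset_apply]
  split_ifs with hi
  · have := ci_le σ i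
    nlinarith [Nat.zero_le (i * σ i)]
  · exact (ci_bd h0 h i (by omega)).le

lemma ci_wdeg (n : ℕ) (σ : ℕ →₀ ℕ) (hs : ∀ i, n < i → σ i = 0) :
    wdeg σ = ∑ i ∈ range n, (i + 1) * σ (i + 1) := by
  rw [wdeg, Finsupp.sum_of_support_subset _ (ci_sum_eq n σ hs) _ (by simp), sum_range_succ']
  simp

lemma ci_wdegp (n : ℕ) (σ : ℕ →₀ ℕ) (h0 : σ 0 = 0) (hs : ∀ i, n < i → σ i = 0) :
    wdegp σ = wdeg σ + ∑ i ∈ range n, σ (i + 1) := by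
  rw [ci_wdeg n σ hs, wdegp, Finsupp.sum_of_support_subset _ (ci_sum_eq n σ hs) _ (by simp),
    sum_range_succ', ← sum_add_distrib]
  simp only [h0, mul_zero, add_zero]
  exact sum_congr rfl fun i _ => by ring

open Polynomial in
lemma ci_tuple (c : ℕ → ℝ) (n k : ℕ) (hk : k ≤ n) :
    (∑ᶠ j ∈ {j : Fin k → ℕ | ∑ b, (j b + 1) = n}, ∏ b, c (j b)) =
      ∑ τ ∈ (piAntidiag (range (n + 1)) k).filter (fun τ => ∑ i ∈ range (n + 1), i * τ i = n - k),
        (Nat.multinomial (range (n + 1)) τ : ℝ) * ∏ i ∈ range (n + 1), c i ^ τ i := by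
  have hset : {j : Fin k → ℕ | ∑ b, (j b + 1) = n} =
      ↑((Fintype.piFinset (fun _ : Fin k => range (n + 1))).filter
        (fun j => ∑ b, j b = n - k)) := by
    ext j
    simp only [Set.mem_setOf_eq, coe_filter, Fintype.mem_piFinset, mem_range, sum_add_distrib,
      sum_const, card_univ, Fintype.card_fin, smul_eq_mul, mul_one]
    constructor
    · intro h
      refine ⟨fun b => ?_, by omega⟩
      have := Finset.single_le_sum (f := j) (fun _ _ => Nat.zero_le _) (mem_univ b)
      omega
    · rintro ⟨_, h⟩
      omega
  rw [hset, finsum_mem_coe_finset]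
  have h1 : (∑ i ∈ range (n + 1), monomial i (c i)) ^ k =
      ∑ j ∈ Fintype.piFinset (fun _ : Fin k => range (n + 1)),
        monomial (∑ b, j b) (∏ b, c (j b)) := by
    rw [← Fin.prod_const, prod_univ_sum]
    refine sum_congr rfl fun j _ => ?_
    simp only [← C_mul_X_pow_eq_monomial, prod_mul_distrib, prod_pow_eq_pow_sum, map_prod]
  have h2 : (∑ i ∈ range (n + 1), monomial i (c i)) ^ k =
      ∑ τ ∈ piAntidiag (range (n + 1)) k,
        monomial (∑ i ∈ range (n + 1), i * τ i)
          ((Nat.multinomial (range (n + 1)) τ : ℝ) * ∏ i ∈ range (n + 1), c i ^ τ i) := by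
    rw [sum_pow_eq_sum_piAntidiag]
    refine sum_congr rfl fun j _ => ?_
    simp only [← C_mul_X_pow_eq_monomial, mul_pow, prod_mul_distrib, ← pow_mul,
      prod_pow_eq_pow_sum, map_prod, map_mul, map_pow, map_natCast, mul_assoc]
  have h3 := congrArg (fun p => coeff p (n - k)) (h1.symm.trans h2)
  simpa only [finset_sum_coeff, coeff_monomial, ← sum_filter] using h3

lemma ci_reindex (c : ℕ → ℝ) (hc : c 0 = 1) (n k : ℕ) (hk : k ≤ n) (S : Finset (ℕ →₀ ℕ))
    (hS : ∀ σ, σ ∈ S ↔ σ 0 = 0 ∧ wdegp σ ≤ n) :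
    ∑ τ ∈ (piAntidiag (range (n + 1)) k).filter (fun τ => ∑ i ∈ range (n + 1), i * τ i = n - k),
        (Nat.multinomial (range (n + 1)) τ : ℝ) * ∏ i ∈ range (n + 1), c i ^ τ i =
    ∑ σ ∈ S.filter (fun σ => n - wdeg σ = k), (k.factorial : ℝ) /
            (((n - wdegp σ).factorial : ℝ) * (σ.prod fun _ k => (k.factorial : ℝ)))
          * (σ.prod fun i k => (c i) ^ k) := by
  symm
  refine sum_bij' (fun σ _ => fun x => if x = 0 then n - wdegp σ else σ x)
    (fun τ _ => Finsupp.onFinset (range (n + 1)) (fun x => if x ≠ 0 ∧ x < n + 1 then τ x else 0)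
      (by intro a; simp; omega)) ?_ ?_ ?_ ?_ ?_
  · intro σ hσ
    obtain ⟨hσ, hk'⟩ := mem_filter.1 hσ
    obtain ⟨h0, hle⟩ := (hS σ).1 hσ
    have hb := ci_bd h0 hle
    have e1 := ci_wdeg n σ hb
    have e2 := ci_wdegp n σ h0 hb
    simp only [mem_filter, mem_piAntidiag]
    refine ⟨⟨?_, ?_⟩, ?_⟩
    · rw [sum_range_succ']
      simp only [Nat.add_eq_zero_iff, one_ne_zero, and_false, if_false, if_true]
      omega
    · intro i hi
      rw [mem_range]
      by_contra h
      have := hb i (by omega)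
      have h' : i ≠ 0 := by omega
      simp [h', this] at hi
    · rw [sum_range_succ']
      simp only [Nat.add_eq_zero_iff, one_ne_zero, and_false, if_false, if_true]
      omega
  · intro τ hτ
    simp only [mem_filter, mem_piAntidiag] at hτ
    obtain ⟨⟨h1, h2⟩, h3⟩ := hτ
    set σ : ℕ →₀ ℕ := Finsupp.onFinset (range (n + 1))
      (fun x => if x ≠ 0 ∧ x < n + 1 then τ x else 0) (by intro a; simp; omega) with hσ
    have h0 : σ 0 = 0 := by simp [hσ]
    have hb : ∀ i, n < i → σ i = 0 := by
      intro i hi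
      simp [hσ]; omega
    have hv : ∀ i ∈ range n, σ (i + 1) = τ (i + 1) := by
      intro i hi
      rw [mem_range] at hi
      simp [hσ, hi]
    have e1 := ci_wdeg n σ hb
    have e2 := ci_wdegp n σ h0 hb
    rw [sum_congr rfl hv] at e2
    rw [sum_congr rfl (fun i hi => by rw [hv i hi])] at e1
    rw [sum_range_succ'] at h1 h3
    rw [mem_filter, hS]
    omega
  · intro σ hσ
    obtain ⟨hσ, hk'⟩ := mem_filter.1 hσ
    obtain ⟨h0, hle⟩ := (hS σ).1 hσ
    have hb := ci_bd h0 hle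
    ext x
    simp only [Finsupp.onFinset_apply]
    by_cases hx : x = 0
    · simp [hx, h0]
    · by_cases hx' : x < n + 1
      · simp [hx, hx']
      · simp [hx', hb x (by omega)]
  · intro τ hτ
    simp only [mem_filter, mem_piAntidiag] at hτ
    obtain ⟨⟨h1, h2⟩, h3⟩ := hτ
    set σ : ℕ →₀ ℕ := Finsupp.onFinset (range (n + 1))
      (fun x => if x ≠ 0 ∧ x < n + 1 then τ x else 0) (by intro a; simp; omega) with hσ
    have h0 : σ 0 = 0 := by simp [hσ]
    have hb : ∀ i, n < i → σ i = 0 := by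
      intro i hi
      simp [hσ]; omega
    have hv : ∀ i ∈ range n, σ (i + 1) = τ (i + 1) := by
      intro i hi
      rw [mem_range] at hi
      simp [hσ, hi]
    have e1 := ci_wdeg n σ hb
    have e2 := ci_wdegp n σ h0 hb
    rw [sum_congr rfl hv] at e2
    rw [sum_congr rfl (fun i hi => by rw [hv i hi])] at e1
    rw [sum_range_succ'] at h1 h3
    funext x
    by_cases hx : x = 0
    · subst hx
      simp only [if_true]
      omega
    · simp only [hx, if_false]
      by_cases hx' : x < n + 1
      · simp only [hσ, Finsupp.onFinset_apply]
        rw [if_pos ⟨hx, hx'⟩]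
      · rw [hb x (by omega)]
        by_contra h
        exact hx' (mem_range.1 (h2 x (Ne.symm h)))
  · intro σ hσ
    obtain ⟨hσ, hk'⟩ := mem_filter.1 hσ
    obtain ⟨h0, hle⟩ := (hS σ).1 hσ
    have hb := ci_bd h0 hle
    have e1 := ci_wdeg n σ hb
    have e2 := ci_wdegp n σ h0 hb
    have hsub := ci_sum_eq n σ hb
    have hm := Nat.multinomial_spec (range (n + 1)) (fun x => if x = 0 then n - wdegp σ else σ x)
    rw [Finsupp.prod_of_support_subset _ hsub _ (by simp),
      Finsupp.prod_of_support_subset _ hsub _ (by simp)]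
    have hsum : ∑ i ∈ range (n + 1), (fun x => if x = 0 then n - wdegp σ else σ x) i = k := by
      rw [sum_range_succ']
      simp only [Nat.add_eq_zero_iff, one_ne_zero, and_false, if_false, if_true]
      omega
    rw [hsum] at hm
    rw [← hm]
    rw [prod_range_succ', prod_range_succ', prod_range_succ', prod_range_succ']
    simp only [Nat.add_eq_zero_iff, one_ne_zero, and_false, if_false, if_true, hc, h0,
      Nat.factorial_zero, one_pow, mul_one, pow_zero, Nat.cast_one]
    push_cast
    congr 1
    have f1 : ((n - wdegp σ).factorial : ℝ) ≠ 0 := by positivity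
    have f2 : (∏ i ∈ range n, ((σ (i + 1)).factorial : ℝ)) ≠ 0 :=
      prod_ne_zero_iff.2 fun i _ => by positivity
    field_simp

/-- Identity (rilt.20): if `L` satisfies the chain renormalization recursion
`L n = ℓ^n − ∑_σ [n!/((n−|σ|₊)! ∏ σ(i)!)] (∏ c(i)^{σ(i)}) L(n−|σ|)`, then
`ℓ^n = ∑_{k=0}^n (n!/k!) ∑_{(j₁,...,j_k), ∑(j_b+1)=n} (∏_b c(j_b)) L k`. -/
theorem chain_inversion (ℓ : ℝ) (c : ℕ → ℝ) (hc : c 0 = 1) (L : ℕ → ℝ)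
    (hL0 : L 0 = 1)
    (hL : ∀ n : ℕ, 1 ≤ n →
      L n = ℓ ^ n - ∑ᶠ σ ∈ {σ : ℕ →₀ ℕ | σ 0 = 0 ∧ 1 ≤ wdeg σ ∧ wdegp σ ≤ n},
        (n.factorial : ℝ) /
            (((n - wdegp σ).factorial : ℝ) * (σ.prod fun _ k => (k.factorial : ℝ)))
          * (σ.prod fun i k => (c i) ^ k) * L (n - wdeg σ)) :
    ∀ n : ℕ, ℓ ^ n = ∑ k ∈ range (n + 1),
      (n.factorial : ℝ) / (k.factorial : ℝ) *
        (∑ᶠ j ∈ {j : Fin k → ℕ | ∑ b, (j b + 1) = n}, ∏ b, c (j b)) * L k := by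
  intro n
  have hS : ∀ σ, σ ∈ (ci_finite n).toFinset ↔ σ 0 = 0 ∧ wdegp σ ≤ n := by
    intro σ; simp
  set S := (ci_finite n).toFinset with hSdef
  have h0S : (0 : ℕ →₀ ℕ) ∈ S := by rw [hS]; simp [wdegp]
  have hwd : ∀ σ ∈ S, wdeg σ ≤ n ∧ (1 ≤ wdeg σ ↔ σ ≠ 0) := by
    intro σ hσ
    obtain ⟨h0, hle⟩ := (hS σ).1 hσ
    have hb := ci_bd h0 hle
    have e2 := ci_wdegp n σ h0 hb
    refine ⟨by omega, ?_, ?_⟩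
    · rintro h rfl
      simp [wdeg] at h
    · intro h
      obtain ⟨i, hi⟩ := Finsupp.ne_iff.1 h
      have hi' : i ∈ σ.support := Finsupp.mem_support_iff.2 hi
      have h1 := Finset.single_le_sum (f := fun i => i * σ i) (fun _ _ => Nat.zero_le _) hi'
      have h2 : i ≠ 0 := by rintro rfl; exact hi h0
      have h3 : 0 < i * σ i := Nat.mul_pos (Nat.pos_of_ne_zero h2) (Nat.pos_of_ne_zero hi)
      exact h3.trans_le h1
  have key : ℓ ^ n = ∑ σ ∈ S, (n.factorial : ℝ) /
            (((n - wdegp σ).factorial : ℝ) * (σ.prod fun _ k => (k.factorial : ℝ)))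
          * (σ.prod fun i k => (c i) ^ k) * L (n - wdeg σ) := by
    rw [← add_sum_erase _ _ h0S]
    have hz : (n.factorial : ℝ) ≠ 0 := by positivity
    rcases Nat.eq_zero_or_pos n with hn | hn
    · rw [sum_eq_zero]
      · subst hn
        simp [wdegp, wdeg, hL0]
      · intro σ hσ
        obtain ⟨hne, hσ⟩ := mem_erase.1 hσ
        have := hwd σ hσ
        have := this.2.2 hne
        omega
    · have hset : {σ : ℕ →₀ ℕ | σ 0 = 0 ∧ 1 ≤ wdeg σ ∧ wdegp σ ≤ n} = ↑(S.erase 0) := by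
        ext σ
        simp only [Set.mem_setOf_eq, mem_coe, mem_erase]
        constructor
        · rintro ⟨a, b, d⟩
          have hm := (hS σ).2 ⟨a, d⟩
          exact ⟨(hwd σ hm).2.1 b, hm⟩
        · rintro ⟨a, hm⟩
          exact ⟨((hS σ).1 hm).1, (hwd σ hm).2.2 a, ((hS σ).1 hm).2⟩
      have h := hL n hn
      rw [hset, finsum_mem_coe_finset] at h
      have e0 : wdeg 0 = 0 := by simp [wdeg]
      have e1 : wdegp 0 = 0 := by simp [wdegp]
      rw [e0, e1]
      simp only [Finsupp.prod_zero_index, Nat.sub_zero, mul_one, div_self hz, one_mul]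
      linarith
  rw [key, ← sum_fiberwise_of_maps_to (t := range (n + 1)) (g := fun σ => n - wdeg σ)
    (fun σ _ => mem_range.2 (by omega))]
  refine sum_congr rfl fun k hk => ?_
  have hk' : k ≤ n := by have := mem_range.1 hk; omega
  rw [ci_tuple c n k hk', ci_reindex c hc n k hk' S hS, mul_sum, sum_mul]
  refine sum_congr rfl fun σ hσ => ?_
  rw [(mem_filter.1 hσ).2]
  have hz : (k.factorial : ℝ) ≠ 0 := by positivity
  congr 1
  rw [← mul_assoc]
  congr 1
  field_simp
end

section
/- (Identity (15.5)/(15.7): inversion of the Wick renormalization recursion by chains and cycles.) Let h ∈ ℝ, let c : ℕ → ℝ be any sequence with c(0) = 1, and let d(j) ∈ ℝ for integers j ≥ 2. Define H̃ : ℕ → ℝ by H̃(0) = 1 and, for n ≥ 1, H̃(n) = h^n − ∑_σ I_n(σ) · H̃(n − |σ|), where σ = (κ, μ) ranges over all pairs of finitely supported functions κ : {1,2,...} → ℕ and μ : {2,3,...} → ℕ with 1 ≤ |σ| and |σ|₊ ≤ n, where |σ| := ∑_{i≥1} i·κ(i) + ∑_{j≥2} j·μ(j), |σ|₊ := ∑_{i≥1}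 (i+1)·κ(i) + ∑_{j≥2} j·μ(j), and I_n(σ) := [ n! / ( (n − |σ|₊)! · ∏_{i≥1} κ(i)! · ∏_{j≥2} μ(j)! ) ] · ∏_{i≥1} c(i)^{κ(i)} · ∏_{j≥2} ( d(j) / (2j) )^{μ(j)}. Then for every n ∈ ℕ: h^n = ∑_{k=0}^{n} A(n,k) · H̃(k), where A(n,k) := (n!/k!) · ∑_{r≥0} (1/r!) · ∑ ( ∏_{a=1}^{r} d(i_a)/(2 i_a) ) · ( ∏_{b=1}^{k} c(j_b) ), the inner sum running over all tuples (i₁,...,i_r; j₁,...,j_k) with each i_a an integer ≥ 2, each j_b a nonnegative integer, and ∑_{a=1}^{r} i_a + ∑_{b=1}^{k} (j_b + 1) = n (only finitely many terms are nonzero). -/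
open Finset

/-- `|σ| = ∑_{i≥1} i·κ(i) + ∑_{j≥2} j·μ(j)` for a chain/cycle pattern `σ = (κ, μ)`. -/
def wdeg2 (σ : (ℕ →₀ ℕ) × (ℕ →₀ ℕ)) : ℕ :=
  (σ.1.sum fun i k => i * k) + (σ.2.sum fun j k => j * k)

/-- `|σ|₊ = ∑_{i≥1} (i+1)·κ(i) + ∑_{j≥2} j·μ(j)` for a chain/cycle pattern `σ = (κ, μ)`. -/
def wdegp2 (σ : (ℕ →₀ ℕ) × (ℕ →₀ ℕ)) : ℕ :=
  (σ.1.sum fun i k => (i + 1) * k) + (σ.2.sum fun j k => j * k)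


open Polynomial in
lemma cc_tuple (s : Finset ℕ) (f : ℕ → ℝ) (w : ℕ → ℕ) (r : ℕ) :
    (∑ i ∈ s, C (f i) * (X : ℝ[X]) ^ (w i)) ^ r
      = ∑ p ∈ Fintype.piFinset (fun _ : Fin r => s),
          C (∏ a, f (p a)) * X ^ (∑ a, w (p a)) := by
  rw [Finset.sum_pow']
  refine Finset.sum_congr rfl fun p _ => ?_
  rw [Finset.prod_mul_distrib, Finset.prod_pow_eq_pow_sum, map_prod]

open Polynomial in
lemma cc_multi (s : Finset ℕ) (f : ℕ → ℝ) (w : ℕ → ℕ) (r : ℕ) :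
    C (1 / (r.factorial : ℝ)) * (∑ i ∈ s, C (f i) * (X : ℝ[X]) ^ (w i)) ^ r
      = ∑ κ ∈ finsuppAntidiag s r,
          C ((κ.prod fun i k => (f i) ^ k) / (κ.prod fun _ k => (k.factorial : ℝ)))
            * X ^ (κ.sum fun i k => w i * k) := by
  rw [Finset.sum_pow_eq_sum_piAntidiag, Finset.mul_sum]
  symm
  refine Finset.sum_bij (fun κ _ => (κ : ℕ → ℕ)) ?_ ?_ ?_ ?_
  · intro κ hκ
    rw [mem_finsuppAntidiag] at hκ
    rw [mem_piAntidiag]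
    exact ⟨hκ.1, fun i hi => hκ.2 (by simpa using hi)⟩
  · intro a _ b _ hab
    exact DFunLike.coe_injective hab
  · intro g hg
    rw [mem_piAntidiag] at hg
    refine ⟨Finsupp.onFinset s g (fun a ha => hg.2 a ha), ?_, rfl⟩
    rw [mem_finsuppAntidiag]
    exact ⟨hg.1, Finsupp.support_onFinset_subset⟩
  · intro κ hκ
    rw [mem_finsuppAntidiag] at hκ
    rw [Finsupp.prod_of_support_subset κ hκ.2 _ (by simp),
      Finsupp.prod_of_support_subset κ hκ.2 _ (by simp),
      Finsupp.sum_of_support_subset κ hκ.2 _ (by simp)]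
    have h1 : ((Nat.multinomial s κ : ℕ) : ℝ[X]) = C ((Nat.multinomial s κ : ℕ) : ℝ) := by simp
    have h2 : ∏ i ∈ s, (C (f i) * (X : ℝ[X]) ^ (w i)) ^ (κ i)
        = C (∏ i ∈ s, f i ^ κ i) * X ^ (∑ i ∈ s, w i * κ i) := by
      simp only [mul_pow, Finset.prod_mul_distrib, map_prod, map_pow, ← pow_mul,
        Finset.prod_pow_eq_pow_sum]
    rw [h1, h2, ← mul_assoc, ← mul_assoc, ← C_mul, ← C_mul]
    congr 2
    have h3 := Nat.multinomial_spec s κ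
    rw [hκ.1] at h3
    have h4 : (∏ i ∈ s, ((κ i).factorial : ℝ)) * (Nat.multinomial s κ : ℝ) = r.factorial := by
      exact_mod_cast h3
    have h5 : (∏ i ∈ s, ((κ i).factorial : ℝ)) ≠ 0 :=
      Finset.prod_ne_zero_iff.2 fun i _ => by positivity
    have h6 : (r.factorial : ℝ) ≠ 0 := by positivity
    rw [div_eq_iff h5, ← mul_one (∏ i ∈ s, f i ^ κ i)]
    field_simp
    rw [← h4]
    ring

open Polynomial in
lemma cc_coeff {α β : Type*} (S : Finset α) (T : Finset β) (u : α → ℝ) (v : β → ℝ)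
    (p : α → ℕ) (q : β → ℕ) (n : ℕ) :
    ((∑ a ∈ S, C (u a) * (X : ℝ[X]) ^ p a) * (∑ b ∈ T, C (v b) * (X : ℝ[X]) ^ q b)).coeff n
      = ∑ x ∈ (S ×ˢ T) with p x.1 + q x.2 = n, u x.1 * v x.2 := by
  rw [Finset.sum_mul_sum, ← Finset.sum_product', Polynomial.finsetSum_coeff, Finset.sum_filter]
  refine Finset.sum_congr rfl fun x _ => ?_
  have : C (u x.1) * (X : ℝ[X]) ^ p x.1 * (C (v x.2) * X ^ q x.2)
      = C (u x.1 * v x.2) * X ^ (p x.1 + q x.2) := by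
    rw [C_mul, pow_add]; ring
  rw [this, coeff_C_mul_X_pow]
  simp only [eq_comm]

/-- cycle weights -/
noncomputable def ccP (d : ℕ → ℝ) (n : ℕ) : Polynomial ℝ :=
  ∑ i ∈ Finset.Icc 2 n, Polynomial.C (d i / (2 * (i : ℝ))) * Polynomial.X ^ i

/-- chain weights -/
noncomputable def ccQ (c : ℕ → ℝ) (n : ℕ) : Polynomial ℝ :=
  ∑ i ∈ Finset.range (n + 1), Polynomial.C (c i) * Polynomial.X ^ (i + 1)

lemma cc_inner (c d : ℕ → ℝ) (n r k : ℕ) :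
    (∑ᶠ ij ∈ {ij : (Fin r → ℕ) × (Fin k → ℕ) |
              (∀ a, 2 ≤ ij.1 a) ∧ (∑ a, ij.1 a) + (∑ b, (ij.2 b + 1)) = n},
            (∏ a, d (ij.1 a) / (2 * (ij.1 a : ℝ))) * ∏ b, c (ij.2 b))
      = (ccP d n ^ r * ccQ c n ^ k).coeff n := by
  unfold ccP ccQ
  rw [cc_tuple _ (fun i => d i / (2 * (i : ℝ))) (fun i => i), cc_tuple _ c (fun i => i + 1),
    cc_coeff, ← finsum_mem_coe_finset]
  refine finsum_mem_congr ?_ fun _ _ => rfl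
  ext ij
  simp only [coe_filter, mem_product, Fintype.mem_piFinset, Set.mem_ofPred_eq, mem_Icc, mem_range]
  constructor
  · rintro ⟨h1, h2⟩
    refine ⟨⟨fun a => ⟨h1 a, ?_⟩, fun b => ?_⟩, h2⟩
    · have := Finset.single_le_sum (f := ij.1) (fun _ _ => Nat.zero_le _) (mem_univ a)
      omega
    · have := Finset.single_le_sum (f := fun b => ij.2 b + 1) (fun _ _ => Nat.zero_le _)
        (mem_univ b)
      omega
  · rintro ⟨⟨h1, _⟩, h2⟩
    exact ⟨fun a => (h1 a).1, h2⟩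

lemma cc_outer (c d : ℕ → ℝ) (n k : ℕ) :
    (∑ᶠ r : ℕ, (1 / (r.factorial : ℝ)) *
          ∑ᶠ ij ∈ {ij : (Fin r → ℕ) × (Fin k → ℕ) |
              (∀ a, 2 ≤ ij.1 a) ∧ (∑ a, ij.1 a) + (∑ b, (ij.2 b + 1)) = n},
            (∏ a, d (ij.1 a) / (2 * (ij.1 a : ℝ))) * ∏ b, c (ij.2 b))
      = ∑ r ∈ range (n + 1), (1 / (r.factorial : ℝ)) * (ccP d n ^ r * ccQ c n ^ k).coeff n := by
  rw [finsum_eq_sum_of_support_subset (s := range (n + 1))]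
  · exact Finset.sum_congr rfl fun r _ => by rw [cc_inner]
  · intro r hr
    by_contra hlt
    apply hr
    have hr' : n + 1 ≤ r := by simpa using hlt
    have : {ij : (Fin r → ℕ) × (Fin k → ℕ) |
              (∀ a, 2 ≤ ij.1 a) ∧ (∑ a, ij.1 a) + (∑ b, (ij.2 b + 1)) = n} = ∅ := by
      rw [Set.eq_empty_iff_forall_notMem]
      rintro ij ⟨h1, h2⟩
      have := Finset.card_nsmul_le_sum univ ij.1 2 (fun a _ => h1 a)
      simp only [card_univ, Fintype.card_fin, smul_eq_mul] at this
      have h3 : univ.sum ij.1 = ∑ a, ij.1 a := rfl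
      rw [h3] at this
      omega
    simp only [this]
    simp

/-- the weight of a full pattern -/
noncomputable def ccW (c d : ℕ → ℝ) (σ : (ℕ →₀ ℕ) × (ℕ →₀ ℕ)) : ℝ :=
  ((σ.2.prod fun j k => (d j / (2 * (j : ℝ))) ^ k) / (σ.2.prod fun _ k => (k.factorial : ℝ)))
  * ((σ.1.prod fun i k => (c i) ^ k) / (σ.1.prod fun _ k => (k.factorial : ℝ)))

lemma cc_A (c d : ℕ → ℝ) (n r k : ℕ) :
    1 / (k.factorial : ℝ) * ((1 / (r.factorial : ℝ)) * (ccP d n ^ r * ccQ c n ^ k).coeff n)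
      = ∑ x ∈ (finsuppAntidiag (Finset.Icc 2 n) r ×ˢ finsuppAntidiag (Finset.range (n+1)) k)
          with wdegp2 (x.2, x.1) = n, ccW c d (x.2, x.1) := by
  have h1 := cc_multi (Finset.Icc 2 n) (fun i => d i / (2 * (i : ℝ))) (fun i => i) r
  have h2 := cc_multi (Finset.range (n+1)) c (fun i => i + 1) k
  have h3 := cc_coeff (finsuppAntidiag (Finset.Icc 2 n) r) (finsuppAntidiag (Finset.range (n+1)) k)
    (fun μ => (μ.prod fun j k => (d j / (2 * (j : ℝ))) ^ k) / (μ.prod fun _ k => (k.factorial : ℝ)))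
    (fun κ => (κ.prod fun i k => (c i) ^ k) / (κ.prod fun _ k => (k.factorial : ℝ)))
    (fun μ => μ.sum fun j k => j * k) (fun κ => κ.sum fun i k => (i + 1) * k) n
  rw [← h1, ← h2] at h3
  have h4 : 1 / (k.factorial : ℝ) * ((1 / (r.factorial : ℝ)) * (ccP d n ^ r * ccQ c n ^ k).coeff n)
    = ((Polynomial.C (1 / (r.factorial : ℝ)) * ccP d n ^ r) *
       (Polynomial.C (1 / (k.factorial : ℝ)) * ccQ c n ^ k)).coeff n := by
    rw [← Polynomial.coeff_C_mul, ← Polynomial.coeff_C_mul]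
    congr 1
    ring
  rw [h4]
  unfold ccP ccQ
  rw [h3]
  refine Finset.sum_congr ?_ fun _ _ => rfl
  refine Finset.filter_congr fun x _ => ?_
  simp only [wdegp2]
  rw [add_comm]

/-- full patterns -/
def ccF (n : ℕ) : Set ((ℕ →₀ ℕ) × (ℕ →₀ ℕ)) :=
  {σ | σ.2 0 = 0 ∧ σ.2 1 = 0 ∧ wdegp2 σ = n}

lemma cc_le_sum (μ : ℕ →₀ ℕ) (w : ℕ → ℕ) (i : ℕ) (hi : i ∈ μ.support) :
    w i ≤ μ.sum fun j k => w j * k := by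
  have h1 := Finset.single_le_sum (f := fun j => w j * μ j) (fun _ _ => Nat.zero_le _) hi
  have h2 : 1 ≤ μ i := Nat.one_le_iff_ne_zero.2 (by simpa using hi)
  calc w i ≤ w i * μ i := Nat.le_mul_of_pos_right _ h2
    _ ≤ _ := h1

lemma cc_rhs (c d : ℕ → ℝ) (H : ℕ → ℝ) (n : ℕ) :
    ∑ k ∈ range (n + 1),
      ((n.factorial : ℝ) / (k.factorial : ℝ) *
        ∑ᶠ r : ℕ, (1 / (r.factorial : ℝ)) *
          ∑ᶠ ij ∈ {ij : (Fin r → ℕ) × (Fin k → ℕ) |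
              (∀ a, 2 ≤ ij.1 a) ∧ (∑ a, ij.1 a) + (∑ b, (ij.2 b + 1)) = n},
            (∏ a, d (ij.1 a) / (2 * (ij.1 a : ℝ))) * ∏ b, c (ij.2 b)) * H k
    = ∑ᶠ σ ∈ ccF n, (n.factorial : ℝ) * ccW c d σ * H (σ.1.sum fun _ k => k) := by
  have h1 : ∀ k ∈ range (n + 1), ((n.factorial : ℝ) / (k.factorial : ℝ) *
        ∑ᶠ r : ℕ, (1 / (r.factorial : ℝ)) *
          ∑ᶠ ij ∈ {ij : (Fin r → ℕ) × (Fin k → ℕ) |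
              (∀ a, 2 ≤ ij.1 a) ∧ (∑ a, ij.1 a) + (∑ b, (ij.2 b + 1)) = n},
            (∏ a, d (ij.1 a) / (2 * (ij.1 a : ℝ))) * ∏ b, c (ij.2 b)) * H k
      = ∑ r ∈ range (n + 1),
        ∑ x ∈ (finsuppAntidiag (Finset.Icc 2 n) r ×ˢ finsuppAntidiag (Finset.range (n+1)) k)
          with wdegp2 (x.2, x.1) = n,
          (n.factorial : ℝ) * ccW c d (x.2, x.1) * H (x.2.sum fun _ k => k) := by
    intro k _
    rw [cc_outer, Finset.mul_sum, Finset.sum_mul]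
    refine Finset.sum_congr rfl fun r _ => ?_
    have := cc_A c d n r k
    rw [div_eq_mul_one_div, mul_assoc (n.factorial : ℝ), this, Finset.mul_sum, Finset.sum_mul]
    refine Finset.sum_congr rfl fun x hx => ?_
    simp only [mem_filter, mem_product, mem_finsuppAntidiag'] at hx
    rw [hx.1.2.1]
  rw [Finset.sum_congr rfl h1, Finset.sum_sigma', Finset.sum_sigma', ← finsum_mem_coe_finset]
  refine finsum_mem_eq_of_bijOn (fun y => (y.2.2, y.2.1)) ?_ ?_
  · refine ⟨?_, ?_, ?_⟩
    · rintro ⟨⟨k, r⟩, μ, κ⟩ hy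
      simp only [coe_sigma, Set.mem_sigma_iff, mem_coe, mem_sigma, mem_filter, mem_product, mem_finsuppAntidiag'] at hy
      refine ⟨?_, ?_, hy.2.2⟩
      · by_contra h0
        have := hy.2.1.1.2 (Finsupp.mem_support_iff.2 h0)
        simp at this
      · by_contra h0
        have := hy.2.1.1.2 (Finsupp.mem_support_iff.2 h0)
        simp at this
    · rintro ⟨⟨k, r⟩, μ, κ⟩ hy ⟨⟨k', r'⟩, μ', κ'⟩ hy' heq
      simp only [coe_sigma, Set.mem_sigma_iff, mem_coe, mem_sigma, mem_filter, mem_product, mem_finsuppAntidiag'] at hy hy'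
      simp only [Prod.mk.injEq] at heq
      obtain ⟨rfl, rfl⟩ := heq
      have e1 := hy.2.1.1.1.symm.trans hy'.2.1.1.1
      have e2 := hy.2.1.2.1.symm.trans hy'.2.1.2.1
      subst e1 e2
      rfl
    · rintro ⟨κ, μ⟩ ⟨h0, h1, h2⟩
      simp only at h0 h1
      have hs : μ.support ⊆ Finset.Icc 2 n := by
        intro i hi
        have := cc_le_sum μ (fun i => i) i hi
        rw [mem_Icc]
        refine ⟨?_, ?_⟩
        · have h3 := Finsupp.mem_support_iff.1 hi
          by_contra hlt
          have : i = 0 ∨ i = 1 := by omega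
          rcases this with rfl | rfl <;> contradiction
        · simp only [wdegp2] at h2; omega
      refine ⟨⟨⟨κ.sum fun _ k => k, μ.sum fun _ k => k⟩, μ, κ⟩, ?_, rfl⟩
      simp only [coe_sigma, Set.mem_sigma_iff, mem_coe, mem_sigma, mem_filter, mem_product, mem_finsuppAntidiag', mem_range]
      refine ⟨⟨?_, ?_⟩, ⟨⟨trivial, hs⟩, trivial, ?_⟩, h2⟩
      · have : (κ.sum fun _ k => k) ≤ κ.sum fun i k => (i + 1) * k :=
          Finset.sum_le_sum fun i _ => Nat.le_mul_of_pos_left _ (by omega)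
        simp only [wdegp2] at h2; omega
      · have : (μ.sum fun _ k => k) ≤ μ.sum fun i k => i * k :=
          Finset.sum_le_sum fun i hi => Nat.le_mul_of_pos_left _ (by
            have := mem_Icc.1 (hs hi); omega)
        simp only [wdegp2] at h2; omega
      · intro i hi
        have := cc_le_sum κ (fun i => i + 1) i hi
        simp only [wdegp2] at h2
        rw [mem_range]; omega
  · intro y _
    rfl

/-- restricted patterns -/
def ccU (n : ℕ) : Set ((ℕ →₀ ℕ) × (ℕ →₀ ℕ)) :=
  {σ | σ.1 0 = 0 ∧ σ.2 0 = 0 ∧ σ.2 1 = 0 ∧ wdegp2 σ ≤ n}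

/-- the summand of the recursion -/
noncomputable def ccI (c d : ℕ → ℝ) (H : ℕ → ℝ) (n : ℕ) (σ : (ℕ →₀ ℕ) × (ℕ →₀ ℕ)) : ℝ :=
  (n.factorial : ℝ) /
            (((n - wdegp2 σ).factorial : ℝ) * (σ.1.prod fun _ k => (k.factorial : ℝ))
              * (σ.2.prod fun _ k => (k.factorial : ℝ)))
          * (σ.1.prod fun i k => (c i) ^ k)
          * (σ.2.prod fun j k => (d j / (2 * (j : ℝ))) ^ k)
          * H (n - wdeg2 σ)

lemma cc_erase_sum (κ : ℕ →₀ ℕ) (w : ℕ → ℕ) :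
    (κ.sum fun i k => w i * k) = w 0 * κ 0 + (κ.erase 0).sum fun i k => w i * k := by
  by_cases h : 0 ∈ κ.support
  · rw [Finsupp.add_sum_erase κ 0 (fun i k => w i * k) h]
  · rw [Finsupp.erase_of_notMem_support h, Finsupp.notMem_support_iff.1 h]; simp

lemma cc_erase_prod (κ : ℕ →₀ ℕ) (f : ℕ → ℕ → ℝ) (hf : ∀ i, f i 0 = 1) :
    κ.prod f = f 0 (κ 0) * (κ.erase 0).prod f := by
  by_cases h : 0 ∈ κ.support
  · rw [Finsupp.mul_prod_erase κ 0 f h]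
  · rw [Finsupp.erase_of_notMem_support h, Finsupp.notMem_support_iff.1 h, hf]; simp

lemma cc_bij (c d : ℕ → ℝ) (hc : c 0 = 1) (H : ℕ → ℝ) (n : ℕ) :
    ∑ᶠ σ ∈ ccF n, (n.factorial : ℝ) * ccW c d σ * H (σ.1.sum fun _ k => k)
      = ∑ᶠ σ ∈ ccU n, ccI c d H n σ := by
  have key : ∀ κ μ : ℕ →₀ ℕ, wdegp2 (κ, μ) = κ 0 + wdegp2 (κ.erase 0, μ) := by
    intro κ μ
    simp only [wdegp2]
    rw [cc_erase_sum κ (fun i => i + 1)]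
    ring
  refine finsum_mem_eq_of_bijOn (fun σ => (σ.1.erase 0, σ.2)) ⟨?_, ?_, ?_⟩ ?_
  · rintro ⟨κ, μ⟩ ⟨h0, h1, h2⟩
    refine ⟨by simp, h0, h1, ?_⟩
    rw [key] at h2
    simp only
    omega
  · rintro ⟨κ, μ⟩ ⟨h0, h1, h2⟩ ⟨κ', μ'⟩ ⟨h0', h1', h2'⟩ heq
    simp only [Prod.mk.injEq] at heq
    obtain ⟨he, rfl⟩ := heq
    rw [key] at h2 h2'
    rw [he] at h2
    have h3 : κ 0 = κ' 0 := by omega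
    congr 1
    ext i
    by_cases hi : i = 0
    · rw [hi, h3]
    · rw [← Finsupp.erase_ne (f := κ) hi, he, Finsupp.erase_ne hi]
  · rintro ⟨κ, μ⟩ ⟨h, h0, h1, h2⟩
    simp only at h h0 h1
    have he : (κ.update 0 (n - wdegp2 (κ, μ))).erase 0 = κ := by
      ext i
      by_cases hi : i = 0
      · rw [hi, h]; simp
      · rw [Finsupp.erase_ne hi]; simp [hi]
    refine ⟨(κ.update 0 (n - wdegp2 (κ, μ)), μ), ⟨h0, h1, ?_⟩, ?_⟩
    · rw [key, he]
      simp
      omega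
    · simp only [he]
  · rintro ⟨κ, μ⟩ ⟨h0, h1, h2⟩
    rw [key] at h2
    have hA : n - wdegp2 (κ.erase 0, μ) = κ 0 := by omega
    have hB : n - wdeg2 (κ.erase 0, μ) = κ.sum fun _ k => k := by
      have e1 := cc_erase_sum κ (fun _ => 1)
      simp only [one_mul] at e1
      have e2 : ((κ.erase 0).sum fun i k => (i + 1) * k)
          = ((κ.erase 0).sum fun i k => i * k) + (κ.erase 0).sum fun _ k => k := by
        rw [← Finsupp.sum_add]
        exact Finsupp.sum_congr fun i _ => by ring
      simp only [wdegp2] at h2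
      simp only [wdeg2]
      omega
    simp only [ccI, ccW]
    rw [hA, hB, cc_erase_prod κ (fun i k => c i ^ k) (by simp),
      cc_erase_prod κ (fun _ k => (k.factorial : ℝ)) (by simp), hc, one_pow]
    rw [mul_comm (κ 0).factorial.cast] 
    simp only [div_eq_mul_inv, mul_inv]
    ring

lemma cc_Ufin (n : ℕ) : (ccU n).Finite := by
  have hfin : Set.Finite {κ : ℕ →₀ ℕ | (κ.support ⊆ range (n+1)) ∧ ∀ i, κ i ≤ n} := by
    refine (Finset.finite_toSet (Finset.Iic
      (Finsupp.onFinset (range (n+1)) (fun i => if i ∈ range (n+1) then n else 0)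
        (by intro a ha; by_contra hh; simp [hh] at ha)))).subset ?_
    rintro κ ⟨h1, h2⟩
    simp only [coe_Iic, Set.mem_Iic]
    intro i
    simp only [Finsupp.onFinset_apply]
    split_ifs with hi
    · exact h2 i
    · have : i ∉ κ.support := fun hh => hi (h1 hh)
      simp [Finsupp.notMem_support_iff.1 this]
  refine (hfin.prod hfin).subset ?_
  rintro ⟨κ, μ⟩ ⟨h, h0, h1, h2⟩
  simp only at h h0 h1
  simp only [wdegp2] at h2
  have aux : ∀ (ν : ℕ →₀ ℕ) (w : ℕ → ℕ) (i : ℕ), i ∈ ν.support → w i * ν i ≤ ν.sum fun j k => w j * k :=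
    fun ν w i hi => Finset.single_le_sum (f := fun j => w j * ν j) (fun _ _ => Nat.zero_le _) hi
  refine ⟨⟨?_, ?_⟩, ?_, ?_⟩
  · intro i hi
    have := cc_le_sum κ (fun i => i + 1) i hi
    rw [mem_range]; omega
  · intro i
    by_cases hi : i ∈ κ.support
    · have := aux κ (fun i => i + 1) i hi
      have h3 : κ i ≤ (i + 1) * κ i := Nat.le_mul_of_pos_left _ (by omega)
      simp only at this ⊢
      omega
    · simp [Finsupp.notMem_support_iff.1 hi]
  · intro i hi
    have := cc_le_sum μ (fun i => i) i hi
    rw [mem_range]; omega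
  · intro i
    by_cases hi : i ∈ μ.support
    · have := aux μ (fun i => i) i hi
      have hpos : 0 < i := by
        rcases Nat.eq_zero_or_pos i with rfl | hp
        · exact absurd h0 (Finsupp.mem_support_iff.1 hi)
        · exact hp
      have h3 : μ i ≤ i * μ i := Nat.le_mul_of_pos_left _ hpos
      simp only at this ⊢
      omega
    · simp [Finsupp.notMem_support_iff.1 hi]

lemma cc_zero (σ : (ℕ →₀ ℕ) × (ℕ →₀ ℕ)) (h1 : σ.1 0 = 0) (h2 : σ.2 0 = 0)
    (h : wdeg2 σ = 0) : σ = 0 := by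
  obtain ⟨κ, μ⟩ := σ
  simp only [wdeg2] at h h1 h2
  have aux : ∀ ν : ℕ →₀ ℕ, ν 0 = 0 → (ν.sum fun i k => i * k) = 0 → ν = 0 := by
    intro ν h0 hs
    ext i
    by_contra hi
    have hi' : i ∈ ν.support := Finsupp.mem_support_iff.2 hi
    have := cc_le_sum ν (fun i => i) i hi'
    have : i = 0 := by omega
    subst this
    exact hi h0
  rw [aux κ h1 (by omega), aux μ h2 (by omega)]
  rfl

/-- Identity (15.5)/(15.7): if `H̃` satisfies the chain/cycle renormalization
recursion `H̃ n = h^n − ∑_σ I_n(σ) H̃(n−|σ|)`, then `h^n = ∑_{k=0}^n A(n,k) H̃ k`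
with `A(n,k) = (n!/k!) ∑_{r≥0} (1/r!) ∑_{(i;j), ∑ i_a + ∑ (j_b+1) = n, i_a ≥ 2}
(∏_a d(i_a)/(2 i_a)) (∏_b c(j_b))`. -/
theorem chain_cycle_inversion (h : ℝ) (c : ℕ → ℝ) (hc : c 0 = 1) (d : ℕ → ℝ)
    (H : ℕ → ℝ) (hH0 : H 0 = 1)
    (hH : ∀ n : ℕ, 1 ≤ n →
      H n = h ^ n - ∑ᶠ σ ∈ {σ : (ℕ →₀ ℕ) × (ℕ →₀ ℕ) |
          σ.1 0 = 0 ∧ σ.2 0 = 0 ∧ σ.2 1 = 0 ∧ 1 ≤ wdeg2 σ ∧ wdegp2 σ ≤ n},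
        (n.factorial : ℝ) /
            (((n - wdegp2 σ).factorial : ℝ) * (σ.1.prod fun _ k => (k.factorial : ℝ))
              * (σ.2.prod fun _ k => (k.factorial : ℝ)))
          * (σ.1.prod fun i k => (c i) ^ k)
          * (σ.2.prod fun j k => (d j / (2 * (j : ℝ))) ^ k)
          * H (n - wdeg2 σ)) :
    ∀ n : ℕ, h ^ n = ∑ k ∈ range (n + 1),
      ((n.factorial : ℝ) / (k.factorial : ℝ) *
        ∑ᶠ r : ℕ, (1 / (r.factorial : ℝ)) *
          ∑ᶠ ij ∈ {ij : (Fin r → ℕ) × (Fin k → ℕ) |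
              (∀ a, 2 ≤ ij.1 a) ∧ (∑ a, ij.1 a) + (∑ b, (ij.2 b + 1)) = n},
            (∏ a, d (ij.1 a) / (2 * (ij.1 a : ℝ))) * ∏ b, c (ij.2 b)) * H k := by
  intro n
  rw [cc_rhs, cc_bij c d hc H n]
  have hU : ccU n = insert 0 {σ : (ℕ →₀ ℕ) × (ℕ →₀ ℕ) |
          σ.1 0 = 0 ∧ σ.2 0 = 0 ∧ σ.2 1 = 0 ∧ 1 ≤ wdeg2 σ ∧ wdegp2 σ ≤ n} := by
    ext σ
    simp only [ccU, Set.mem_insert_iff, Set.mem_ofPred_eq]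
    constructor
    · rintro ⟨h1, h2, h3, h4⟩
      rcases Nat.eq_zero_or_pos (wdeg2 σ) with h5 | h5
      · exact Or.inl (cc_zero σ h1 h2 h5)
      · exact Or.inr ⟨h1, h2, h3, h5, h4⟩
    · rintro (rfl | ⟨h1, h2, h3, _, h4⟩)
      · simp [wdegp2]
      · exact ⟨h1, h2, h3, h4⟩
  have h0 : ccI c d H n 0 = H n := by
    have : (n.factorial : ℝ) ≠ 0 := by positivity
    simp [ccI, wdeg2, wdegp2, this]
  have hfin := cc_Ufin n
  rw [hU] at hfin ⊢
  rw [finsum_mem_insert _ (by simp [wdeg2]) (hfin.subset (Set.subset_insert _ _)), h0]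
  rcases Nat.eq_zero_or_pos n with rfl | hn
  · have hE : {σ : (ℕ →₀ ℕ) × (ℕ →₀ ℕ) |
          σ.1 0 = 0 ∧ σ.2 0 = 0 ∧ σ.2 1 = 0 ∧ 1 ≤ wdeg2 σ ∧ wdegp2 σ ≤ 0} = ∅ := by
      rw [Set.eq_empty_iff_forall_notMem]
      rintro σ ⟨_, _, _, h4, h5⟩
      have : (σ.1.sum fun i k => i * k) ≤ σ.1.sum fun i k => (i + 1) * k :=
        Finset.sum_le_sum fun i _ => Nat.mul_le_mul_right _ (by omega)
      simp only [wdeg2, wdegp2] at h4 h5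
      omega
    rw [hE]
    simp [hH0]
  · have := hH n hn
    simp only [ccI]
    linarith
end

section
/- (Toy-model generating function (15.2b)/(15.1).) Let ℓ and u be real numbers, and define L : ℕ → ℝ by the recursion L(0) = 1 and, for n ≥ 1, L(n) = ℓ^n − ∑_σ [ n! / ( (n − |σ|₊)! · ∏_{i≥1} σ(i)! ) ] · ( ∏_{i≥1} (u^i)^{σ(i)} ) · L(n − |σ|), where the sum runs over all finitely supported functions σ : {1,2,3,...} → ℕ with 1 ≤ |σ| and |σ|₊ ≤ n. Then for every real s with |s·u| < 1, the series ∑_{n=0}^∞ (s^n/n!) · L(n) converges and equals exp( s·ℓ / (1 + s·u) ). -/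
open Finset

noncomputable section

/-- index set -/
def tset (p m : ℕ) : Finset (ℕ → ℕ) :=
  (piAntidiag (range (m + 1)) p).filter (fun τ => ∑ i ∈ range (m + 1), i * τ i = m)

lemma tset_sum (p m : ℕ) (hm : 1 ≤ m) :
    ∑ τ ∈ tset p m, (Nat.multinomial (range (m + 1)) τ : ℝ) = ((p + m - 1).choose m : ℝ) := by
  have h1 : PowerSeries.coeff m ((∑ i ∈ range (m + 1), (PowerSeries.X : PowerSeries ℝ) ^ i) ^ p)
      = ∑ τ ∈ tset p m, (Nat.multinomial (range (m + 1)) τ : ℝ) := by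
    rw [Finset.sum_pow_eq_sum_piAntidiag, map_sum, tset, Finset.sum_filter]
    refine Finset.sum_congr rfl fun τ _ => ?_
    simp_rw [← pow_mul]
    rw [Finset.prod_pow_eq_pow_sum, ← map_natCast (PowerSeries.C (R := ℝ)), PowerSeries.coeff_C_mul,
      PowerSeries.coeff_X_pow]
    simp [eq_comm]
  have h2 : ((PowerSeries.trunc (m + 1) (PowerSeries.mk 1 : PowerSeries ℝ) : Polynomial ℝ) :
      PowerSeries ℝ) = ∑ i ∈ range (m + 1), (PowerSeries.X : PowerSeries ℝ) ^ i := by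
    ext j
    rw [map_sum]
    simp [PowerSeries.coeff_trunc, PowerSeries.coeff_X_pow]
  have h3 : PowerSeries.coeff m ((PowerSeries.mk 1 : PowerSeries ℝ) ^ p)
      = PowerSeries.coeff m ((∑ i ∈ range (m + 1), (PowerSeries.X : PowerSeries ℝ) ^ i) ^ p) := by
    have := PowerSeries.trunc_trunc_pow (PowerSeries.mk 1 : PowerSeries ℝ) (m + 1) p
    rw [h2] at this
    have := congrArg (fun q => q.coeff m) this
    simpa [PowerSeries.coeff_trunc] using this.symm
  rw [← h1, ← h3]
  rcases p with _ | p
  · have : m ≠ 0 := by omega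
    simp [PowerSeries.coeff_one, this, Nat.choose_eq_zero_of_lt (show m - 1 < m by omega)]
  · rw [PowerSeries.mk_one_pow_eq_mk_choose_add, PowerSeries.coeff_mk,
      show p + 1 + m - 1 = p + m by omega, ← Nat.choose_symm_add]

lemma supp_sub (σ : ℕ →₀ ℕ) : σ.support ⊆ range (wdeg σ + 1) := by
  intro i hi
  have h : i * σ i ≤ wdeg σ :=
    Finset.single_le_sum (f := fun i => i * σ i) (fun _ _ => Nat.zero_le _) hi
  have : 0 < σ i := Nat.pos_of_ne_zero (Finsupp.mem_support_iff.1 hi)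
  have := Nat.le_mul_of_pos_right i this
  simp; omega

lemma wdeg_eq (σ : ℕ →₀ ℕ) (m : ℕ) (h : σ.support ⊆ range (m + 1)) :
    wdeg σ = ∑ i ∈ range (m + 1), i * σ i := 
  Finsupp.sum_of_support_subset _ h _ (by simp)

lemma wdegp_eq (σ : ℕ →₀ ℕ) (m : ℕ) (h : σ.support ⊆ range (m + 1)) :
    wdegp σ = wdeg σ + ∑ i ∈ range (m + 1), σ i := by
  rw [wdeg_eq σ m h, ← Finset.sum_add_distrib, wdegp,
    Finsupp.sum_of_support_subset _ h _ (by simp)]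
  exact Finset.sum_congr rfl fun i _ => by ring

lemma sum_upd (m a : ℕ) (f : ℕ → ℕ) (h : f 0 = 0) :
    ∑ i ∈ range (m + 1), Function.update f 0 a i = a + ∑ i ∈ range (m + 1), f i := by
  rw [Finset.sum_range_succ', Finset.sum_range_succ']
  simp [h, add_comm]

lemma sum_upd' (m a : ℕ) (f : ℕ → ℕ) :
    ∑ i ∈ range (m + 1), i * Function.update f 0 a i = ∑ i ∈ range (m + 1), i * f i := by
  rw [Finset.sum_range_succ', Finset.sum_range_succ']
  simp

lemma prod_upd (m a : ℕ) (f : ℕ → ℕ) (h : f 0 = 0) :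
    ∏ i ∈ range (m + 1), (Function.update f 0 a i).factorial
      = a.factorial * ∏ i ∈ range (m + 1), (f i).factorial := by
  rw [Finset.prod_range_succ', Finset.prod_range_succ']
  simp [h, mul_comm]

lemma finsum_eq (u : ℝ) (L : ℕ → ℝ) (n : ℕ) :
    ∑ᶠ σ ∈ {σ : ℕ →₀ ℕ | σ 0 = 0 ∧ 1 ≤ wdeg σ ∧ wdegp σ ≤ n},
        (n.factorial : ℝ) /
            (((n - wdegp σ).factorial : ℝ) * (σ.prod fun _ k => (k.factorial : ℝ)))
          * (σ.prod fun i k => (u ^ i) ^ k) * L (n - wdeg σ)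
    = ∑ m ∈ Icc 1 n, (n.factorial : ℝ) / ((n - m).factorial : ℝ) * ((n - 1).choose m : ℝ)
        * u ^ m * L (n - m) := by
  have key := finsum_mem_eq_of_bijOn
    (s := {σ : ℕ →₀ ℕ | σ 0 = 0 ∧ 1 ≤ wdeg σ ∧ wdegp σ ≤ n})
    (t := (((Icc 1 n).sigma fun m => tset (n - m) m : Finset (Σ _ : ℕ, (ℕ → ℕ))) :
      Set (Σ _ : ℕ, (ℕ → ℕ))))
    (f := fun σ => (n.factorial : ℝ) /
            (((n - wdegp σ).factorial : ℝ) * (σ.prod fun _ k => (k.factorial : ℝ)))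
          * (σ.prod fun i k => (u ^ i) ^ k) * L (n - wdeg σ))
    (g := fun x => (n.factorial : ℝ) / ((n - x.1).factorial : ℝ) *
       (Nat.multinomial (range (x.1 + 1)) x.2 : ℝ) * u ^ x.1 * L (n - x.1))
    (fun σ => ⟨wdeg σ, Function.update σ 0 (n - wdegp σ)⟩) ?_ ?_
  · rw [key, finsum_mem_coe_finset, Finset.sum_sigma]
    refine Finset.sum_congr rfl fun m hm => ?_
    rw [mem_Icc] at hm
    simp only
    rw [← Finset.sum_mul, ← Finset.sum_mul, ← Finset.mul_sum, tset_sum _ _ hm.1,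
      show n - m + m - 1 = n - 1 by omega]
  · refine ⟨?_, ?_, ?_⟩
    · rintro σ ⟨h0, h1, h2⟩
      have hs := supp_sub σ
      have e1 := wdeg_eq σ _ hs
      have e2 := wdegp_eq σ _ hs
      simp only [Finset.mem_coe, Finset.mem_sigma, mem_Icc, tset, Finset.mem_filter, mem_piAntidiag]
      rw [sum_upd' , ← e1, sum_upd _ _ _ h0]
      refine ⟨⟨h1, by omega⟩, ⟨by omega, ?_⟩, rfl⟩
      intro i hi
      rcases eq_or_ne i 0 with rfl | h
      · simp
      · rw [Function.update_of_ne h] at hi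
        exact hs (Finsupp.mem_support_iff.2 hi)
    · rintro σ ⟨h0, _⟩ σ' ⟨h0', _⟩ h
      simp only [Sigma.mk.injEq, heq_eq_eq] at h
      ext i
      rcases eq_or_ne i 0 with rfl | hi
      · rw [h0, h0']
      · simpa [Function.update_of_ne hi] using congrFun h.2 i
    · rintro ⟨m, τ⟩ hx
      simp only [Finset.mem_coe, Finset.mem_sigma, mem_Icc, tset, Finset.mem_filter,
        mem_piAntidiag] at hx
      obtain ⟨⟨hm1, hmn⟩, ⟨hs, hτ⟩, hw⟩ := hx
      let σ : ℕ →₀ ℕ := Finsupp.onFinset (range (m + 1)) (Function.update τ 0 0) (by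
        intro i hi
        rcases eq_or_ne i 0 with rfl | h
        · simp
        · rw [Function.update_of_ne h] at hi
          exact hτ i hi)
      have hc : (σ : ℕ → ℕ) = Function.update τ 0 0 := rfl
      have hσ0 : σ 0 = 0 := by simp [hc]
      have hτσ : τ = Function.update σ 0 (τ 0) := by simp [hc]
      have hsub : σ.support ⊆ range (m + 1) := Finsupp.support_onFinset_subset
      have e1 := wdeg_eq σ _ hsub
      have e2 := wdegp_eq σ _ hsub
      rw [hc, sum_upd', hw] at e1
      rw [hτσ, sum_upd _ _ _ hσ0] at hs
      refine ⟨σ, ⟨hσ0, by omega, by omega⟩, ?_⟩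
      simp only [e1, Sigma.mk.injEq, heq_eq_eq, true_and]
      rw [show n - wdegp σ = τ 0 by omega]
      exact hτσ.symm
  · rintro σ ⟨h0, h1, h2⟩
    have hs := supp_sub σ
    have e2 := wdegp_eq σ _ hs
    have e3 : (σ.prod fun i k => (u ^ i) ^ k) = u ^ wdeg σ := by
      simp_rw [← pow_mul]
      exact Finset.prod_pow_eq_pow_sum _ _ _
    have e4 : (σ.prod fun _ k => (k.factorial : ℝ))
        = ((∏ i ∈ range (wdeg σ + 1), (σ i).factorial : ℕ) : ℝ) := by
      rw [Finsupp.prod_of_support_subset _ hs _ (by simp)]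
      push_cast; rfl
    have e5 := Nat.multinomial_spec (range (wdeg σ + 1)) (Function.update σ 0 (n - wdegp σ))
    rw [prod_upd _ _ _ h0, sum_upd _ _ _ h0,
      show n - wdegp σ + ∑ i ∈ range (wdeg σ + 1), σ i = n - wdeg σ by omega] at e5
    simp only
    rw [e3, e4, ← e5]
    have n1 : ((n - wdegp σ).factorial : ℝ) ≠ 0 := by positivity
    have n2 : ((∏ i ∈ range (wdeg σ + 1), (σ i).factorial : ℕ) : ℝ) ≠ 0 := by
      exact_mod_cast (Nat.prod_factorial_pos _ _).ne'
    have n3 : (Nat.multinomial (range (wdeg σ + 1)) (Function.update σ 0 (n - wdegp σ)) : ℝ) ≠ 0 := by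
      exact_mod_cast (Nat.multinomial_pos _ _).ne'
    generalize Nat.multinomial (range (wdeg σ + 1)) (Function.update σ 0 (n - wdegp σ)) = M at *
    generalize (∏ i ∈ range (wdeg σ + 1), (σ i).factorial) = P at *
    push_cast
    field_simp

/-- binomial inversion -/
lemma inversion (u : ℝ) (a e : ℕ → ℝ)
    (h : ∀ N, ∑ x ∈ antidiagonal N, ((N.choose x.1 : ℕ) : ℝ) * u ^ x.1 * a x.2 = e N) (N : ℕ) :
    a N = ∑ x ∈ antidiagonal N, ((N.choose x.1 : ℕ) : ℝ) * (-u) ^ x.1 * e x.2 := by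
  have conv : ∀ (v : ℝ) (f : ℕ → ℝ) (N : ℕ),
      PowerSeries.coeff N (PowerSeries.mk (fun n => v ^ n / n.factorial) *
        PowerSeries.mk (fun n => f n / n.factorial))
      = (∑ x ∈ antidiagonal N, ((N.choose x.1 : ℕ) : ℝ) * v ^ x.1 * f x.2) / N.factorial := by
    intro v f N
    rw [PowerSeries.coeff_mul, Finset.sum_div]
    refine Finset.sum_congr rfl fun x hx => ?_
    rw [HasAntidiagonal.mem_antidiagonal] at hx
    subst hx
    rw [Nat.cast_add_choose]
    simp only [PowerSeries.coeff_mk]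
    field_simp
  have hE : PowerSeries.mk (fun n => (-u) ^ n / n.factorial) *
      PowerSeries.mk (fun n => u ^ n / n.factorial) = (1 : PowerSeries ℝ) := by
    ext N
    rw [conv, PowerSeries.coeff_one]
    have := add_pow (-u) u N
    rw [Finset.Nat.sum_antidiagonal_eq_sum_range_succ
      (fun i j => ((N.choose i : ℕ) : ℝ) * (-u) ^ i * u ^ j)]
    rw [Finset.sum_congr rfl (g := fun i => (-u) ^ i * u ^ (N - i) * (N.choose i : ℝ))
      (fun i _ => by ring), ← this]
    rcases N with _ | N <;> simp
  have h1 : PowerSeries.mk (fun n => u ^ n / n.factorial) *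
      PowerSeries.mk (fun n => a n / n.factorial) = PowerSeries.mk (fun n => e n / n.factorial) := by
    ext N
    rw [conv, h, PowerSeries.coeff_mk]
  have h2 := congrArg (fun q => PowerSeries.mk (fun n => (-u) ^ n / n.factorial) * q) h1
  simp only [← mul_assoc, hE, one_mul] at h2
  have h3 := congrArg (PowerSeries.coeff N) h2
  rw [conv, PowerSeries.coeff_mk] at h3
  field_simp at h3
  exact h3


lemma main_sum (ℓ u s : ℝ) (hs : |s * u| < 1) :
    HasSum (fun N : ℕ => s ^ (N + 1) * ∑ x ∈ antidiagonal N,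
      ((N.choose x.1 : ℕ) : ℝ) * (-u) ^ x.1 * (ℓ ^ (x.2 + 1) / (x.2 + 1).factorial))
      (Real.exp (s * ℓ / (1 + s * u)) - 1) := by
  let F : ℕ × ℕ → ℝ := fun x => s ^ (x.1 + x.2 + 1) * (((x.1 + x.2).choose x.1 : ℝ) * (-u) ^ x.2 *
    (ℓ ^ (x.1 + 1) / (x.1 + 1).factorial))
  have hexp : ∀ y : ℝ, HasSum (fun j : ℕ => y ^ (j + 1) / (j + 1).factorial) (Real.exp y - 1) := by
    intro y
    have := NormedSpace.expSeries_div_hasSum_exp y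
    rw [← Real.exp_eq_exp_ℝ] at this
    simpa using (hasSum_nat_add_iff' (f := fun n : ℕ => y ^ n / n.factorial) 1).2 this
  have hin : ∀ (s u ℓ : ℝ), |s * u| < 1 → ∀ j : ℕ,
      HasSum (fun i : ℕ => s ^ (j + i + 1) * (((j + i).choose j : ℝ) * (-u) ^ i *
    (ℓ ^ (j + 1) / (j + 1).factorial)))
      ((s * ℓ / (1 + s * u)) ^ (j + 1) / (j + 1).factorial) := by
    intro s u ℓ hs j
    have h := (hasSum_choose_mul_geometric_of_norm_lt_one (𝕜 := ℝ) j (r := -(s * u))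
      (by simpa using hs)).mul_left ((s * ℓ) ^ (j + 1) / (j + 1).factorial)
    convert! h using 1
    · ext i
      rw [add_comm j i, neg_mul_eq_mul_neg]
      ring
    · rw [sub_neg_eq_add, div_pow]
      ring
  have hsum : Summable F := by
    rw [← summable_norm_iff]
    have hF : ∀ x, ‖F x‖ = |s| ^ (x.1 + x.2 + 1) * (((x.1 + x.2).choose x.1 : ℝ) * (-(-|u|)) ^ x.2 *
        (|ℓ| ^ (x.1 + 1) / (x.1 + 1).factorial)) := by
      intro x
      simp [F]
    have h' : |(|s| * (-|u|))| < 1 := by simpa [abs_mul] using hs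
    rw [summable_prod_of_nonneg (fun _ => norm_nonneg _)]
    simp only [hF]
    refine ⟨fun j => (hin _ _ _ h' j).summable, ?_⟩
    simp only [(hin |s| (-|u|) |ℓ| h' _).tsum_eq]
    exact (hexp _).summable
  have hF1 : HasSum F (Real.exp (s * ℓ / (1 + s * u)) - 1) := by
    have h1 := hsum.hasSum.prod_fiberwise (fun j => hin s u ℓ hs j)
    rw [← h1.unique (hexp _)]
    exact hsum.hasSum
  have hF2 := (Finset.HasAntidiagonal.sigmaAntidiagonalEquivProd (A := ℕ)).hasSum_iff.2 hF1
  have hF3 := hF2.sigma (fun N => hasSum_fintype _)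
  convert! hF3 using 1
  ext N
  refine Eq.trans ?_ (Finset.sum_attach (antidiagonal N) (fun x => F x)).symm
  rw [Finset.mul_sum, ← Finset.Nat.sum_antidiagonal_swap]
  refine Finset.sum_congr rfl fun x hx => ?_
  rw [HasAntidiagonal.mem_antidiagonal] at hx
  subst hx
  simp only [F, Prod.fst_swap, Prod.snd_swap]
  rw [Nat.choose_symm_add]

end

/-- Toy-model generating function (15.2b)/(15.1): if `L` satisfies the chain
renormalization recursion with chain weights `c(i) = u^i`, then for `|s u| < 1`
the series `∑_{n≥0} (s^n/n!) L n` converges to `exp(s ℓ/(1 + s u))`. -/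
theorem toy_generating (ℓ u : ℝ) (L : ℕ → ℝ) (hL0 : L 0 = 1)
    (hL : ∀ n : ℕ, 1 ≤ n →
      L n = ℓ ^ n - ∑ᶠ σ ∈ {σ : ℕ →₀ ℕ | σ 0 = 0 ∧ 1 ≤ wdeg σ ∧ wdegp σ ≤ n},
        (n.factorial : ℝ) /
            (((n - wdegp σ).factorial : ℝ) * (σ.prod fun _ k => (k.factorial : ℝ)))
          * (σ.prod fun i k => (u ^ i) ^ k) * L (n - wdeg σ))
    (s : ℝ) (hs : |s * u| < 1) :
    HasSum (fun n : ℕ => s ^ n / (n.factorial : ℝ) * L n)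
      (Real.exp (s * ℓ / (1 + s * u))) := by
  have hrec : ∀ N : ℕ, ∑ x ∈ antidiagonal N, ((N.choose x.1 : ℕ) : ℝ) * u ^ x.1 *
      (L (x.2 + 1) / (x.2 + 1).factorial) = ℓ ^ (N + 1) / (N + 1).factorial := by
    intro N
    have h := hL (N + 1) (by omega)
    rw [finsum_eq] at h
    rw [Finset.Nat.sum_antidiagonal_eq_sum_range_succ
      (fun i j => ((N.choose i : ℕ) : ℝ) * u ^ i * (L (j + 1) / (j + 1).factorial))]
    rw [Finset.sum_Icc_succ_top (by omega)] at h
    simp only [Nat.add_sub_cancel, Nat.choose_succ_self, Nat.cast_zero, mul_zero, zero_mul,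
      add_zero] at h
    have h2 : ∑ m ∈ Icc 1 N, ((N + 1).factorial : ℝ) / ((N + 1 - m).factorial : ℝ)
        * (N.choose m : ℝ) * u ^ m * L (N + 1 - m) = (N + 1).factorial *
        ∑ k ∈ range N, ((N.choose (k + 1) : ℕ) : ℝ) * u ^ (k + 1) *
          (L (N - (k + 1) + 1) / (N - (k + 1) + 1).factorial) := by
      rw [Finset.mul_sum, Finset.range_eq_Ico,
        Finset.sum_Ico_add' (fun k => ((N + 1).factorial : ℝ) * (((N.choose k : ℕ) : ℝ) * u ^ k *
          (L (N - k + 1) / (N - k + 1).factorial))) 0 N 1]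
      refine Finset.sum_congr (by ext; simp) fun m hm => ?_
      simp only [mem_Ico] at hm
      rw [show N + 1 - m = N - m + 1 by omega]
      ring
    rw [h2] at h
    rw [Finset.sum_range_succ', eq_div_iff (by positivity)]
    have h3 : ((N + 1).factorial : ℝ) ≠ 0 := by positivity
    simp only [Nat.choose_zero_right, Nat.cast_one, pow_zero, Nat.sub_zero, one_mul]
    rw [add_mul, div_mul_cancel₀ _ h3]
    linarith
  have hb := inversion u (fun n => L (n + 1) / (n + 1).factorial)
    (fun n => ℓ ^ (n + 1) / (n + 1).factorial) hrec
  rw [← hasSum_nat_add_iff' 1]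
  convert! main_sum ℓ u s hs using 1
  · ext N
    rw [← hb N]
    ring
  · simp [hL0]
end
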